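/- arXiv:2501.06889 — 2 statements merged into one kernel-verified Lean document; each statement's English description precedes it below -/
import Mathlib

section
/- For every real r > 0 there exists a constant C_r > 0 such that for every integer a ≥ 8 and every real number x with 1 ≤ x ≤ a^r, the number of triples of integers (m, w, o) with w ≥ 1, (a² + 3a + 3)·m + (a+1)·w > 0, (a² + 3a + 3)·o − (a+2)·w > 0 and Nm(m − w·ρ + o·ρ²) ≤ x is at most C_r·((log a)²·x/a² + (x/a)^(2/3)). -/
open NumberField

/-- The largest real root of `X³ - aX² - (a+3)X - 1` (for `a ≥ 7` this set of real roots
is nonempty and bounded above, so `sSup` picks out the largest root). -/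
noncomputable def simplestCubicRoot (a : ℤ) : ℝ :=
  sSup {x : ℝ | x ^ 3 - (a : ℝ) * x ^ 2 - ((a : ℝ) + 3) * x - 1 = 0}

open Polynomial in
/-- The simplest cubic polynomial over `ℚ`. -/
noncomputable def simplestCubic (a : ℤ) : ℚ[X] :=
  X ^ 3 - C (a : ℚ) * X ^ 2 - C ((a : ℚ) + 3) * X - 1

open Polynomial in
theorem simplestCubic_natDegree (a : ℤ) : (simplestCubic a).natDegree = 3 := by
  unfold simplestCubic
  compute_degree!

open Polynomial in
theorem simplestCubic_monic (a : ℤ) : (simplestCubic a).Monic := by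
  unfold simplestCubic
  monicity!

open Polynomial in
theorem simplestCubic_irreducible (a : ℤ) : Irreducible (simplestCubic a) := by
  rw [Polynomial.irreducible_iff_roots_eq_zero_of_degree_le_three
    (by rw [simplestCubic_natDegree]; norm_num) (by rw [simplestCubic_natDegree])]
  rw [Multiset.eq_zero_iff_forall_notMem]
  intro x hx
  have hx0 : x ^ 3 - (a : ℚ) * x ^ 2 - ((a : ℚ) + 3) * x - 1 = 0 := by
    have := (Polynomial.mem_roots'.1 hx).2
    simpa [simplestCubic, Polynomial.IsRoot] using this
  have hint : IsIntegral ℤ x := by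
    obtain ⟨b, hb⟩ : ∃ b : ℤ, b = a + 3 := ⟨_, rfl⟩
    have hb' : (b : ℚ) = a + 3 := by exact_mod_cast hb
    refine ⟨X ^ 3 - C a * X ^ 2 - C b * X - 1, by monicity!, ?_⟩
    rw [← Polynomial.aeval_def]
    simpa [hb'] using hx0
  obtain ⟨n, rfl⟩ := IsIntegrallyClosed.isIntegral_iff.1 hint
  have hn : n ^ 3 - a * n ^ 2 - (a + 3) * n - 1 = 0 := by
    simp only [eq_intCast] at hx0
    exact_mod_cast hx0
  have hd : n * (n ^ 2 - a * n - (a + 3)) = 1 := by linarith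
  rcases Int.isUnit_iff.1 (IsUnit.of_mul_eq_one _ hd) with rfl | rfl
  · ring_nf at hn; omega
  · ring_nf at hn; omega

/-- The norm form of the basis `1, -ρ, ρ²` of a simplest cubic field. -/
def simplestCubicNormForm {R : Type*} [CommRing R] (a m w o : R) : R :=
  m ^ 3 - a * m ^ 2 * w + (a ^ 2 + 2 * a + 6) * m ^ 2 * o - (a + 3) * m * w ^ 2
    + (a ^ 2 + 3 * a + 3) * m * w * o + (a ^ 2 + 4 * a + 9) * m * o ^ 2 - w ^ 3
    + a * w ^ 2 * o + (a + 3) * w * o ^ 2 + o ^ 3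

theorem norm_eq_simplestCubicNormForm (a : ℤ) {K : Type*} [Field K] [NumberField K] {ρ : K}
    (hρ : ρ ^ 3 - (a : K) * ρ ^ 2 - ((a : K) + 3) * ρ - 1 = 0)
    (htop : IntermediateField.adjoin ℚ {ρ} = ⊤) (m w o : ℤ) :
    Algebra.norm ℚ ((m : K) - (w : K) * ρ + (o : K) * ρ ^ 2) =
      ((simplestCubicNormForm a m w o : ℤ) : ℚ) := by
  have hmin : minpoly ℚ ρ = simplestCubic a := by
    refine (minpoly.eq_of_irreducible_of_monic (simplestCubic_irreducible a) ?_
      (simplestCubic_monic a)).symm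
    simpa [simplestCubic] using hρ
  have hdeg : (minpoly ℚ ρ).natDegree = 3 := by rw [hmin, simplestCubic_natDegree]
  have hfin : Module.finrank ℚ K = 3 := by
    rw [← hdeg, ← IntermediateField.adjoin.finrank (Algebra.IsIntegral.isIntegral ρ), htop,
      IntermediateField.finrank_top']
  have hli : LinearIndependent ℚ fun i : Fin 3 => ρ ^ (i : ℕ) := by
    have := linearIndependent_pow (K := ℚ) ρ
    rw [hdeg] at this
    exact this
  let b := basisOfLinearIndependentOfCardEqFinrank hli (by simp [hfin])
  have hb : ∀ i, b i = ρ ^ (i : ℕ) := fun i => by simp [b]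
  let M : Matrix (Fin 3) (Fin 3) ℚ :=
    !![(m : ℚ), o, a * o - w;
       -w, m + (a + 3) * o, o + (a + 3) * (a * o - w);
       o, a * o - w, m + (a + 3) * o + a * (a * o - w)]
  have hM : Matrix.toLin b b M =
      Algebra.lmul ℚ K ((m : K) - (w : K) * ρ + (o : K) * ρ ^ 2) := by
    refine b.ext fun j => ?_
    rw [Matrix.toLin_self]
    fin_cases j <;>
      simp [Fin.sum_univ_three, hb, M, Algebra.smul_def]
    · ring
    · linear_combination (-(o : K)) * hρ
    · linear_combination (-(o : K) * ρ - (a * o - w)) * hρ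
  rw [Algebra.norm_apply, ← LinearMap.det_toMatrix b]
  have : LinearMap.toMatrix b b ((Algebra.lmul ℚ K) ((m : K) - (w : K) * ρ + (o : K) * ρ ^ 2)) = M
      := by rw [← hM, LinearMap.toMatrix_toLin]
  erw [this]
  simp only [M, Matrix.det_fin_three, simplestCubicNormForm]
  simp
  ring

theorem simplestCubicRoot_isRoot {a : ℤ} (ha : 8 ≤ a) :
    simplestCubicRoot a ^ 3 - (a : ℝ) * simplestCubicRoot a ^ 2
      - ((a : ℝ) + 3) * simplestCubicRoot a - 1 = 0 := by
  have ha' : (8 : ℝ) ≤ a := by exact_mod_cast ha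
  have hcont : Continuous fun x : ℝ => x ^ 3 - (a : ℝ) * x ^ 2 - ((a : ℝ) + 3) * x - 1 := by
    fun_prop
  refine IsClosed.csSup_mem (s := {x : ℝ | x ^ 3 - (a : ℝ) * x ^ 2 - ((a : ℝ) + 3) * x - 1 = 0})
    (isClosed_eq hcont continuous_const) ?_ ⟨2 * a, fun x hx => ?_⟩
  · obtain ⟨x, -, hx⟩ := intermediate_value_Icc (show (0 : ℝ) ≤ 2 * a by linarith)
      hcont.continuousOn (show (0 : ℝ) ∈ Set.Icc _ _ from ⟨by norm_num, by nlinarith⟩)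
    exact ⟨x, hx⟩
  · by_contra! h
    have hx' : x ^ 3 - (a : ℝ) * x ^ 2 - ((a : ℝ) + 3) * x - 1 = 0 := hx
    nlinarith [mul_pos (show 0 < x by linarith) (show 0 < x - 2 * a by linarith),
      mul_pos (mul_pos (show 0 < x by linarith) (show 0 < x by linarith))
        (show 0 < x - 2 * a by linarith)]

/-- The norm form in the coordinates of the cone spanned by three totally positive units. -/
theorem simplestCubicNormForm_cone (a m w o p q : ℤ)
    (hp : p = (a ^ 2 + 3 * a + 3) * m + (a + 1) * w)
    (hq : q = (a ^ 2 + 3 * a + 3) * o - (a + 2) * w) :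
    (a ^ 2 + 3 * a + 3) ^ 3 * simplestCubicNormForm a m w o =
      p ^ 3 + q ^ 3 + w ^ 3 + (a ^ 2 + 2 * a + 6) * (p ^ 2 * q + q ^ 2 * w + w ^ 2 * p)
        + (a ^ 2 + 4 * a + 9) * (p * q ^ 2 + q * w ^ 2 + w * p ^ 2)
        + (a ^ 4 + 6 * a ^ 3 + 21 * a ^ 2 + 36 * a + 33) * (p * q * w) := by
  subst hp hq
  unfold simplestCubicNormForm
  ring

/-- The set `s` is finite, with at most `c` elements. -/
def HasCardLE {α : Type*} (s : Set α) (c : ℝ) : Prop :=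
  s.Finite ∧ (s.ncard : ℝ) ≤ c

theorem HasCardLE.mono {α : Type*} {s : Set α} {c d : ℝ} (hs : HasCardLE s c) (h : c ≤ d) :
    HasCardLE s d :=
  ⟨hs.1, hs.2.trans h⟩

theorem HasCardLE.of_injOn {α β : Type*} {s : Set α} {t : Set β} {c : ℝ} (ht : HasCardLE t c)
    (f : α → β) (hf : ∀ x ∈ s, f x ∈ t) (hinj : Set.InjOn f s) : HasCardLE s c :=
  ⟨Set.Finite.of_injOn hf hinj ht.1,
    le_trans (by exact_mod_cast Set.ncard_le_ncard_of_injOn f hf hinj ht.1) ht.2⟩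

theorem HasCardLE.union {α : Type*} {s t : Set α} {c d : ℝ} (hs : HasCardLE s c)
    (ht : HasCardLE t d) : HasCardLE (s ∪ t) (c + d) :=
  ⟨hs.1.union ht.1, le_trans (by exact_mod_cast Set.ncard_union_le s t) (add_le_add hs.2 ht.2)⟩

theorem HasCardLE.subset {α : Type*} {s t : Set α} {c : ℝ} (ht : HasCardLE t c)
    (h : s ⊆ t) : HasCardLE s c :=
  ht.of_injOn id h Function.injective_id.injOn

theorem HasCardLE.coe_finset {α : Type*} {s : Finset α} {c : ℝ} (h : (s.card : ℝ) ≤ c) :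
    HasCardLE (s : Set α) c :=
  ⟨s.finite_toSet, by rwa [Set.ncard_coe_finset]⟩

/-- Triples of positive integers with product at most `Y`. -/
def boundedTriples (Y : ℝ) : Set (ℤ × ℤ × ℤ) :=
  {t | 1 ≤ t.1 ∧ 1 ≤ t.2.1 ∧ 1 ≤ t.2.2 ∧ (t.1 : ℝ) * t.2.1 * t.2.2 ≤ Y}

/-- Pairs of positive integers with `p * T * max p T` at most `Y`. -/
def boundedPairs (Y : ℝ) : Set (ℤ × ℤ) :=
  {t | 1 ≤ t.1 ∧ 1 ≤ t.2 ∧ (t.1 : ℝ) * t.2 * t.1 ≤ Y ∧ (t.1 : ℝ) * t.2 * t.2 ≤ Y}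

theorem hasCardLE_boundedTriples {Y B : ℝ} (hY : 0 ≤ Y)
    (hB : 1 ≤ Y → 1 + Real.log Y ≤ B) : HasCardLE (boundedTriples Y) (Y * B ^ 2) := by
  rcases lt_or_ge Y 1 with h1 | h1
  · have : boundedTriples Y = ∅ := by
      ext ⟨i, j, k⟩
      simp only [boundedTriples, Set.mem_ofPred_eq, Set.mem_empty_iff_false, iff_false]
      rintro ⟨hi, hj, hk, h⟩
      have : 1 ≤ i * j * k := by nlinarith [mul_pos (show 0 < i by lia) (show 0 < j by lia)]
      have : (1 : ℝ) ≤ i * j * k := by exact_mod_cast this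
      linarith
    rw [this]
    exact ⟨Set.finite_empty, by simp; positivity⟩
  set n := ⌊Y⌋₊ with hn
  let s : Finset ((_ : ℕ × ℕ) × ℕ) :=
    (Finset.Icc 1 n ×ˢ Finset.Icc 1 n).sigma fun ij => Finset.Icc 1 ⌊Y / (ij.1 * ij.2)⌋₊
  have hH : ∑ i ∈ Finset.Icc 1 n, ((i : ℝ))⁻¹ ≤ B := by
    have h := harmonic_floor_le_one_add_log Y h1
    rw [harmonic_eq_sum_Icc] at h
    push_cast at h
    exact h.trans (hB h1)
  have hs : (s.card : ℝ) ≤ Y * B ^ 2 := by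
    simp only [s, Finset.card_sigma, Nat.card_Icc, Nat.add_sub_cancel]
    push_cast
    calc ∑ ij ∈ Finset.Icc 1 n ×ˢ Finset.Icc 1 n, (⌊Y / ((ij.1 : ℝ) * ij.2)⌋₊ : ℝ)
        ≤ ∑ ij ∈ Finset.Icc 1 n ×ˢ Finset.Icc 1 n, Y * ((ij.1 : ℝ)⁻¹ * (ij.2 : ℝ)⁻¹) := by
          refine Finset.sum_le_sum fun ij _ => ?_
          rw [← mul_inv, ← div_eq_mul_inv]
          exact Nat.floor_le (by positivity)
      _ = Y * (∑ i ∈ Finset.Icc 1 n, ((i : ℝ))⁻¹) ^ 2 := by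
          rw [← Finset.mul_sum, sq, Finset.sum_mul_sum, Finset.sum_product]
      _ ≤ Y * B ^ 2 := by gcongr
  refine (HasCardLE.coe_finset hs).of_injOn
    (fun t => ⟨(t.1.toNat, t.2.1.toNat), t.2.2.toNat⟩) ?_ ?_
  · rintro ⟨i, j, k⟩ ⟨hi, hj, hk, h⟩
    lift i to ℕ using by simp at hi; lia
    lift j to ℕ using by simp at hj; lia
    lift k to ℕ using by simp at hk; lia
    simp only [Int.cast_natCast, Nat.one_le_cast] at hi hj hk h
    have hi' : (1 : ℝ) ≤ i := by exact_mod_cast hi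
    have hj' : (1 : ℝ) ≤ j := by exact_mod_cast hj
    have hk' : (1 : ℝ) ≤ k := by exact_mod_cast hk
    have hij : (1 : ℝ) ≤ i * j := one_le_mul_of_one_le_of_one_le hi' hj'
    simp only [s, Finset.coe_sigma, Set.mem_sigma_iff, Finset.mem_coe, Finset.mem_product,
      Finset.mem_Icc, Int.toNat_natCast]
    refine ⟨⟨⟨hi, Nat.le_floor ?_⟩, hj, Nat.le_floor ?_⟩, hk, Nat.le_floor ?_⟩
    · nlinarith [mul_nonneg (show (0 : ℝ) ≤ i by linarith) (show (0 : ℝ) ≤ j - 1 by linarith),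
        mul_nonneg (show (0 : ℝ) ≤ i * j by linarith) (show (0 : ℝ) ≤ k - 1 by linarith)]
    · nlinarith [mul_nonneg (show (0 : ℝ) ≤ j by linarith) (show (0 : ℝ) ≤ i - 1 by linarith),
        mul_nonneg (show (0 : ℝ) ≤ i * j by linarith) (show (0 : ℝ) ≤ k - 1 by linarith)]
    · rw [le_div_iff₀ (by linarith)]
      linarith
  · rintro ⟨i, j, k⟩ ⟨hi, hj, hk, -⟩ ⟨i', j', k'⟩ ⟨hi', hj', hk', -⟩ h
    simp only [Sigma.mk.injEq, Prod.mk.injEq, heq_eq_eq] at *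
    lia

theorem sum_inv_sqrt_le (n : ℕ) : ∑ i ∈ Finset.Icc 1 n, (√(i : ℝ))⁻¹ ≤ 2 * √(n : ℝ) := by
  induction n with
  | zero => simp
  | succ n ih =>
    rw [Finset.sum_Icc_succ_top (by lia)]
    have h1 : 0 < √((n + 1 : ℕ) : ℝ) := Real.sqrt_pos.2 (by positivity)
    have h2 : (√((n + 1 : ℕ) : ℝ)) ^ 2 = n + 1 := by
      rw [Real.sq_sqrt (by positivity)]; push_cast; rfl
    have h3 : (√(n : ℝ)) ^ 2 = n := Real.sq_sqrt (by positivity)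
    have h4 : (√((n + 1 : ℕ) : ℝ))⁻¹ ≤ 2 * √((n + 1 : ℕ) : ℝ) - 2 * √(n : ℝ) := by
      rw [inv_le_iff_one_le_mul₀ h1]
      nlinarith [sq_nonneg (√((n + 1 : ℕ) : ℝ) - √(n : ℝ))]
    linarith

theorem hasCardLE_orderedPairs {Y : ℝ} (hY : 0 ≤ Y) :
    HasCardLE {t : ℤ × ℤ | 1 ≤ t.1 ∧ t.1 ≤ t.2 ∧ (t.1 : ℝ) * t.2 * t.2 ≤ Y}
      (2 * Y ^ ((2 : ℝ) / 3)) := by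
  set M := Y ^ ((1 : ℝ) / 3) with hM
  have hM0 : 0 ≤ M := by positivity
  have hM3 : M ^ 3 = Y := by
    rw [hM, ← Real.rpow_natCast, ← Real.rpow_mul hY]; norm_num
  have hM2 : M ^ 2 = Y ^ ((2 : ℝ) / 3) := by
    rw [hM, ← Real.rpow_natCast, ← Real.rpow_mul hY]; norm_num
  let s : Finset ((_ : ℕ) × ℕ) :=
    (Finset.Icc 1 ⌊M⌋₊).sigma fun p => Finset.Icc 1 ⌊√(Y / p)⌋₊
  have hs : (s.card : ℝ) ≤ 2 * Y ^ ((2 : ℝ) / 3) := by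
    simp only [s, Finset.card_sigma, Nat.card_Icc, Nat.add_sub_cancel]
    push_cast
    calc ∑ p ∈ Finset.Icc 1 ⌊M⌋₊, (⌊√(Y / p)⌋₊ : ℝ)
        ≤ ∑ p ∈ Finset.Icc 1 ⌊M⌋₊, √Y * (√(p : ℝ))⁻¹ := by
          refine Finset.sum_le_sum fun p _ => ?_
          rw [← div_eq_mul_inv, ← Real.sqrt_div hY]
          exact Nat.floor_le (by positivity)
      _ ≤ √Y * (2 * √(⌊M⌋₊ : ℝ)) := by
          rw [← Finset.mul_sum]
          gcongr
          exact sum_inv_sqrt_le _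
      _ ≤ √Y * (2 * √M) := by
          gcongr
          exact Nat.floor_le hM0
      _ = 2 * √(Y * M) := by rw [Real.sqrt_mul hY]; ring
      _ = 2 * Y ^ ((2 : ℝ) / 3) := by
          rw [← hM2, ← hM3, show M ^ 3 * M = (M ^ 2) ^ 2 by ring, Real.sqrt_sq (by positivity)]
  refine (HasCardLE.coe_finset hs).of_injOn (fun t => ⟨t.1.toNat, t.2.toNat⟩) ?_ ?_
  · rintro ⟨p, t⟩ ⟨hp, hpt, h⟩
    lift p to ℕ using by simp at hp; lia
    lift t to ℕ using by simp at hpt; lia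
    simp only [Int.cast_natCast, Nat.one_le_cast, Nat.cast_le] at hp hpt h
    have hp' : (1 : ℝ) ≤ p := by exact_mod_cast hp
    have hpt' : (p : ℝ) ≤ t := by exact_mod_cast hpt
    simp only [s, Finset.coe_sigma, Set.mem_sigma_iff, Finset.mem_coe,
      Finset.mem_Icc, Int.toNat_natCast]
    refine ⟨⟨hp, Nat.le_floor ?_⟩, hp.trans hpt, Nat.le_floor (Real.le_sqrt_of_sq_le ?_)⟩
    · refine le_of_pow_le_pow_left₀ (n := 3) (by norm_num) hM0 ?_
      rw [hM3]
      refine le_trans ?_ h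
      rw [show (p : ℝ) ^ 3 = p * p * p by ring]
      gcongr
    · rw [le_div_iff₀ (by linarith)]
      linarith
  · rintro ⟨p, t⟩ ⟨hp, hpt, -⟩ ⟨p', t'⟩ ⟨hp', hpt', -⟩ h
    simp only [Sigma.mk.injEq, Prod.mk.injEq, heq_eq_eq] at *
    lia

theorem hasCardLE_boundedPairs {Y : ℝ} (hY : 0 ≤ Y) :
    HasCardLE (boundedPairs Y) (4 * Y ^ ((2 : ℝ) / 3)) := by
  have h := hasCardLE_orderedPairs hY
  have h' := h.of_injOn
    (s := {t : ℤ × ℤ | 1 ≤ t.2 ∧ t.2 ≤ t.1 ∧ (t.2 : ℝ) * t.1 * t.1 ≤ Y}) Prod.swap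
    (fun t ht => ht) Prod.swap_injective.injOn
  refine ((h.union h').subset ?_).mono (by linarith)
  rintro ⟨p, t⟩ ⟨hp, ht, h1, h2⟩
  rcases le_total p t with hpt | hpt
  · exact Or.inl ⟨hp, hpt, h2⟩
  · exact Or.inr ⟨ht, hpt, by linarith⟩

/-- Weighted points of the lattice `q ≡ (a + 1) p` modulo `a² + 3a + 3`. -/
def latticePoints (a : ℤ) (X : ℝ) : Set (ℤ × ℤ × ℤ) :=
  {t | 1 ≤ t.1 ∧ 1 ≤ t.2.1 ∧ 1 ≤ t.2.2 ∧ a ^ 2 + 3 * a + 3 ∣ t.2.2 - (a + 1) * t.2.1 ∧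
    (t.1 : ℝ) * (t.2.1 + t.1) * (t.2.2 + t.1) ≤ X}

theorem hasCardLE_latticePoints {a : ℤ} (ha : 8 ≤ a) {X B : ℝ} (hX : 0 ≤ X)
    (hB : 1 ≤ 2 * X / (a : ℝ) ^ 2 → 1 + Real.log (2 * X / (a : ℝ) ^ 2) ≤ B) :
    HasCardLE (latticePoints a X)
      (4 * (X / a) ^ ((2 : ℝ) / 3) + 3 * (2 * X / (a : ℝ) ^ 2 * B ^ 2)) := by
  have ha' : (8 : ℝ) ≤ a := by exact_mod_cast ha
  have hD : (0 : ℤ) < a ^ 2 + 3 * a + 3 := by positivity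
  have hT := hasCardLE_boundedTriples (by positivity) hB
  have hP := hasCardLE_boundedPairs (Y := X / a) (by positivity)
  -- the quotient `k = (q - (a + 1) p) / (a² + 3a + 3)`
  let k : ℤ × ℤ × ℤ → ℤ := fun t => (t.2.2 - (a + 1) * t.2.1) / (a ^ 2 + 3 * a + 3)
  have hk : ∀ t ∈ latticePoints a X,
      t.2.2 = (a + 1) * t.2.1 + (a ^ 2 + 3 * a + 3) * k t := fun t ht => by
    have := Int.mul_ediv_cancel' ht.2.2.2.1
    simp only [k]
    lia
  have h0 : HasCardLE {t ∈ latticePoints a X | k t = 0} (4 * (X / a) ^ ((2 : ℝ) / 3)) := by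
    refine hP.of_injOn (fun t => (t.1, t.2.1)) ?_ ?_
    · rintro t ⟨ht, hkt⟩
      have h := hk t ht
      obtain ⟨h1, h2, h3, -, h5⟩ := ht
      obtain ⟨T, p, q⟩ := t
      simp only [hkt, mul_zero, add_zero] at h h1 h2 h3 h5 ⊢
      subst h
      push_cast at h5
      have h1' : (1 : ℝ) ≤ T := by exact_mod_cast h1
      have h2' : (1 : ℝ) ≤ p := by exact_mod_cast h2
      have key : (T : ℝ) * (p + T) * (a * p) ≤ X := by
        refine le_trans ?_ h5
        gcongr
        nlinarith
      refine ⟨h1, h2, ?_, ?_⟩ <;> rw [le_div_iff₀ (by positivity)] <;> refine le_trans ?_ key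
      · have : 0 ≤ (T : ℝ) * p * (a * p) := by positivity
        linarith
      · have : 0 ≤ (T : ℝ) * T * (a * p) := by positivity
        linarith
    · rintro ⟨T, p, q⟩ ⟨ht, hkt⟩ ⟨T', p', q'⟩ ⟨ht', hkt'⟩ heq
      have h := hk _ ht
      have h' := hk _ ht'
      rw [hkt] at h
      rw [hkt'] at h'
      simp only [Prod.mk.injEq] at heq h h' ⊢
      obtain ⟨rfl, rfl⟩ := heq
      exact ⟨rfl, rfl, by linarith⟩
  have hpos : HasCardLE {t ∈ latticePoints a X | 1 ≤ k t} (2 * X / (a : ℝ) ^ 2 * B ^ 2) := by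
    refine hT.of_injOn (fun t => (t.1, t.2.1, k t)) ?_ ?_
    · rintro t ⟨ht, hkt⟩
      have h := hk t ht
      obtain ⟨h1, h2, h3, -, h5⟩ := ht
      refine ⟨h1, h2, hkt, ?_⟩
      generalize k t = l at *
      obtain ⟨T, p, q⟩ := t
      simp only at h h1 h2 h3 h5 ⊢
      have h1' : (1 : ℝ) ≤ T := by exact_mod_cast h1
      have h2' : (1 : ℝ) ≤ p := by exact_mod_cast h2
      have hkt' : (1 : ℝ) ≤ l := by exact_mod_cast hkt
      have h' : (q : ℝ) = (a + 1) * p + (a ^ 2 + 3 * a + 3) * l := by exact_mod_cast h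
      rw [le_div_iff₀ (by positivity)]
      have hq : (a : ℝ) ^ 2 * l ≤ q + T := by
        rw [h']
        have : 0 ≤ (a + 1) * (p : ℝ) + (3 * a + 3) * l := by positivity
        linarith
      have : (T : ℝ) * p * (a ^ 2 * l) ≤ T * (p + T) * (q + T) := by
        gcongr
        linarith
      linarith
    · rintro ⟨T, p, q⟩ ⟨ht, hkt⟩ ⟨T', p', q'⟩ ⟨ht', hkt'⟩ heq
      have h := hk _ ht
      have h' := hk _ ht'
      simp only [Prod.mk.injEq] at heq
      rw [heq.2.2] at h
      simp only [Prod.mk.injEq] at heq h h' ⊢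
      obtain ⟨rfl, rfl, -⟩ := heq
      exact ⟨rfl, rfl, by linarith⟩
  -- for `k < 0`, the lattice vector is `i (1, a + 1) + β (a + 2, -1)`
  let β : ℤ × ℤ × ℤ → ℤ := fun t => - k t
  let i : ℤ × ℤ × ℤ → ℤ := fun t => t.2.1 - (a + 2) * β t
  have hi : ∀ t ∈ latticePoints a X, t.2.1 = i t + (a + 2) * β t ∧
      t.2.2 = (a + 1) * i t - β t := fun t ht => by
    have := hk t ht
    refine ⟨by simp [i], ?_⟩
    rw [this]
    simp only [i, β]
    ring
  have hneg₁ : HasCardLE {t ∈ latticePoints a X | 1 ≤ β t ∧ β t ≤ t.2.2}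
      (2 * X / (a : ℝ) ^ 2 * B ^ 2) := by
    refine hT.of_injOn (fun t => (t.1, β t, i t)) ?_ ?_
    · rintro t ⟨ht, hβ, hβq⟩
      have h := hi t ht
      obtain ⟨h1, h2, h3, -, h5⟩ := ht
      generalize hβt : β t = b at *
      generalize hit : i t = j at *
      have hj : 1 ≤ j := by
        by_contra! hj
        nlinarith
      refine ⟨h1, hβ, hj, ?_⟩
      obtain ⟨T, p, q⟩ := t
      simp only at h h1 h2 h3 h5 hβq ⊢
      have h1' : (1 : ℝ) ≤ T := by exact_mod_cast h1
      have hb' : (1 : ℝ) ≤ b := by exact_mod_cast hβ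
      have hj' : (1 : ℝ) ≤ j := by exact_mod_cast hj
      have hbq' : (b : ℝ) ≤ q := by exact_mod_cast hβq
      have hp' : (p : ℝ) = j + (a + 2) * b := by exact_mod_cast h.1
      have hq' : (q : ℝ) = (a + 1) * j - b := by exact_mod_cast h.2
      rw [le_div_iff₀ (by positivity)]
      have : (T : ℝ) * (a * b) * (a * j / 2) ≤ T * (p + T) * (q + T) := by
        gcongr <;> nlinarith
      linarith
    · rintro t ⟨ht, -⟩ t' ⟨ht', -⟩ heq
      obtain ⟨h1, h2⟩ := hi t ht
      obtain ⟨h1', h2'⟩ := hi t' ht'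
      simp only [Prod.mk.injEq] at heq
      rw [heq.2.1, heq.2.2, ← h1'] at h1
      rw [heq.2.1, heq.2.2, ← h2'] at h2
      exact Prod.ext heq.1 (Prod.ext h1 h2)
  have hneg₂ : HasCardLE {t ∈ latticePoints a X | 1 ≤ β t ∧ t.2.2 ≤ β t}
      (2 * X / (a : ℝ) ^ 2 * B ^ 2) := by
    refine hT.of_injOn (fun t => (t.1, i t, t.2.2)) ?_ ?_
    · rintro t ⟨ht, hβ, hβq⟩
      have h := hi t ht
      obtain ⟨h1, h2, h3, -, h5⟩ := ht
      generalize hβt : β t = b at *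
      generalize hit : i t = j at *
      have hj : 1 ≤ j := by
        by_contra! hj
        nlinarith
      refine ⟨h1, hj, h3, ?_⟩
      obtain ⟨T, p, q⟩ := t
      simp only at h h1 h2 h3 h5 hβq ⊢
      have h1' : (1 : ℝ) ≤ T := by exact_mod_cast h1
      have h3' : (1 : ℝ) ≤ q := by exact_mod_cast h3
      have hb' : (1 : ℝ) ≤ b := by exact_mod_cast hβ
      have hj' : (1 : ℝ) ≤ j := by exact_mod_cast hj
      have hbq' : (q : ℝ) ≤ b := by exact_mod_cast hβq
      have hp' : (p : ℝ) = j + (a + 2) * b := by exact_mod_cast h.1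
      have hq' : (q : ℝ) = (a + 1) * j - b := by exact_mod_cast h.2
      rw [le_div_iff₀ (by positivity)]
      have hbj : (a : ℝ) * j / 2 ≤ b := by nlinarith
      have hpT : (a : ℝ) * (a * j / 2) ≤ p + T := by
        have : (a : ℝ) * (a * j / 2) ≤ a * b := by gcongr
        linarith
      have : (T : ℝ) * (a * (a * j / 2)) * q ≤ T * (p + T) * (q + T) := by
        gcongr
        linarith
      linarith
    · rintro t ⟨ht, -⟩ t' ⟨ht', -⟩ heq
      obtain ⟨h1, h2⟩ := hi t ht
      obtain ⟨h1', h2'⟩ := hi t' ht'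
      simp only [Prod.mk.injEq] at heq
      rw [heq.2.1, heq.2.2] at h2
      have hb : β t = β t' := by linarith
      rw [heq.2.1, hb, ← h1'] at h1
      exact Prod.ext heq.1 (Prod.ext h1 heq.2.2)
  refine (((h0.union hpos).union (hneg₁.union hneg₂)).subset fun t ht => ?_).mono (by linarith)
  rcases lt_trichotomy (k t) 0 with h | h | h
  · have hb : 1 ≤ β t := by simp only [β]; lia
    rcases le_total (β t) t.2.2 with h' | h'
    · exact Or.inr (Or.inl ⟨ht, hb, h'⟩)
    · exact Or.inr (Or.inr ⟨ht, hb, h'⟩)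
  · exact Or.inl (Or.inl ⟨ht, h⟩)
  · exact Or.inl (Or.inr ⟨ht, h⟩)

/-- Points `p + w u + q ρ²` (scaled by `a² + 3a + 3`) of the cone whose third coordinate is the
largest, with bounded norm. -/
def conePoints (a : ℤ) (x : ℝ) : Set (ℤ × ℤ × ℤ) :=
  {t | 1 ≤ t.1 ∧ 1 ≤ t.2.1 ∧ 1 ≤ t.2.2 ∧ a ^ 2 + 3 * a + 3 ∣ t.2.1 - (a + 1) * t.1 ∧
    a ^ 2 + 3 * a + 3 ∣ t.2.2 - (a + 1) * t.2.1 ∧ t.1 ≤ t.2.2 ∧ t.2.1 ≤ t.2.2 ∧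
    (t.2.2 : ℝ) * (a ^ 2 * t.1 + t.2.2) * (a ^ 2 * t.2.1 + t.2.2) ≤
      ((a : ℝ) ^ 2 + 3 * a + 3) ^ 3 * x}

theorem hasCardLE_conePoints {a : ℤ} (ha : 8 ≤ a) {x c : ℝ}
    (h : HasCardLE (latticePoints a (108 * x)) c) : HasCardLE (conePoints a x) c := by
  have ha' : (8 : ℝ) ≤ a := by exact_mod_cast ha
  obtain ⟨D, hD⟩ : ∃ D : ℤ, D = a ^ 2 + 3 * a + 3 := ⟨_, rfl⟩
  have hD0 : 0 < D := by rw [hD]; positivity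
  have hD' : (D : ℝ) = a ^ 2 + 3 * a + 3 := by exact_mod_cast hD
  have hD2 : (D : ℝ) ≤ 2 * a ^ 2 := by rw [hD']; nlinarith
  have hDa : (a : ℝ) ^ 2 ≤ D := by rw [hD']; linarith
  have hD0' : (0 : ℝ) < D := by exact_mod_cast hD0
  refine h.of_injOn (fun t => (t.2.2 / D + 1, t.1, t.2.1)) ?_ ?_
  · rintro ⟨p, q, w⟩ ⟨h1, h2, h3, h4, h5, h6, h7, h8⟩
    simp only [← hD, ← hD'] at h1 h2 h3 h4 h5 h6 h7 h8
    have hsum : D ∣ p + q + w := by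
      have : p + q + w = (w - (a + 1) * q) + (a + 2) * (q - (a + 1) * p) + D * p := by
        rw [hD]; ring
      rw [this]
      exact dvd_add (dvd_add h5 (h4.mul_left _)) (dvd_mul_right _ _)
    have hle := Int.le_of_dvd (by lia) hsum
    have ht := Int.mul_ediv_self_le (x := w) (ne_of_gt hD0)
    have ht0 : 0 ≤ w / D := Int.ediv_nonneg (by lia) hD0.le
    refine ⟨by simpa using ht0, h1, h2, by simpa [← hD] using h4, ?_⟩
    obtain ⟨T, hT⟩ : ∃ T : ℤ, T = w / D + 1 := ⟨_, rfl⟩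
    simp only [← hT]
    have hT1 : 1 ≤ T := by lia
    have hw : D * T ≤ 3 * w := by
      rw [hT]
      rcases eq_or_lt_of_le ht0 with h0 | h0
      · rw [← h0]; lia
      · nlinarith
    have hw' : (D : ℝ) * T ≤ 3 * w := by exact_mod_cast hw
    have hT1' : (1 : ℝ) ≤ T := by exact_mod_cast hT1
    have h1' : (1 : ℝ) ≤ p := by exact_mod_cast h1
    have h2' : (1 : ℝ) ≤ q := by exact_mod_cast h2
    have hwT : (a : ℝ) ^ 2 * T / 3 ≤ w := by
      have : (a : ℝ) ^ 2 * T ≤ D * T := by gcongr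
      linarith
    have key : (D * T / 3 : ℝ) * (a ^ 2 * p + a ^ 2 * T / 3) * (a ^ 2 * q + a ^ 2 * T / 3) ≤
        D ^ 3 * x := by
      refine le_trans ?_ h8
      gcongr
      linarith
    have hx : 0 ≤ x := by
      by_contra! hx
      have : (0 : ℝ) ≤
        (D * T / 3 : ℝ) * (a ^ 2 * p + a ^ 2 * T / 3) * (a ^ 2 * q + a ^ 2 * T / 3) := by
        positivity
      nlinarith [pow_pos hD0' 3]
    have hDsq : (D : ℝ) ^ 2 ≤ 4 * a ^ 4 := by
      calc (D : ℝ) ^ 2 ≤ (2 * (a : ℝ) ^ 2) ^ 2 := by gcongr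
        _ = 4 * (a : ℝ) ^ 4 := by ring
    have key2 : (D * a ^ 4 : ℝ) * (T * (p + T / 3) * (q + T / 3)) ≤ (D * a ^ 4) * (12 * x) := by
      calc (D * a ^ 4 : ℝ) * (T * (p + T / 3) * (q + T / 3))
          = 3 * ((D * T / 3 : ℝ) * (a ^ 2 * p + a ^ 2 * T / 3) * (a ^ 2 * q + a ^ 2 * T / 3)) := by
            ring
        _ ≤ 3 * (D ^ 3 * x) := by linarith
        _ = 3 * D * x * D ^ 2 := by ring
        _ ≤ 3 * D * x * (4 * a ^ 4) := by gcongr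
        _ = (D * a ^ 4) * (12 * x) := by ring
    have key3 := le_of_mul_le_mul_left key2 (by positivity)
    have : (T : ℝ) * (p + T) * (q + T) ≤ T * (3 * p + T) * (3 * q + T) := by
      gcongr <;> linarith
    linarith
  · rintro ⟨p, q, w⟩ ⟨-, -, -, -, h5, -⟩ ⟨p', q', w'⟩ ⟨-, -, -, -, h5', -⟩ heq
    simp only [Prod.mk.injEq, ← hD] at heq h5 h5' ⊢
    obtain ⟨hw, rfl, rfl⟩ := heq
    refine ⟨rfl, rfl, ?_⟩
    have hmod : w % D = w' % D := by
      rw [Int.emod_eq_emod_iff_emod_sub_eq_zero]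
      refine Int.emod_eq_zero_of_dvd ?_
      simpa using dvd_sub h5 h5'
    rw [← Int.mul_ediv_add_emod w D, ← Int.mul_ediv_add_emod w' D, hmod,
      show w / D = w' / D by lia]

theorem hasCardLE_normBounded {a : ℤ} (ha : 8 ≤ a) {x c : ℝ}
    (h : HasCardLE (conePoints a x) c) :
    HasCardLE {t : ℤ × ℤ × ℤ | 1 ≤ t.2.1 ∧
      0 < (a ^ 2 + 3 * a + 3) * t.1 + (a + 1) * t.2.1 ∧
      0 < (a ^ 2 + 3 * a + 3) * t.2.2 - (a + 2) * t.2.1 ∧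
      ((simplestCubicNormForm a t.1 t.2.1 t.2.2 : ℤ) : ℝ) ≤ x} (3 * c) := by
  obtain ⟨D, hD⟩ : ∃ D : ℤ, D = a ^ 2 + 3 * a + 3 := ⟨_, rfl⟩
  have hD0 : 0 < D := by rw [hD]; positivity
  have hD' : (D : ℝ) = a ^ 2 + 3 * a + 3 := by exact_mod_cast hD
  have hD0' : (0 : ℝ) < D := by exact_mod_cast hD0
  have hrot : HasCardLE {t : ℤ × ℤ × ℤ | (t.2.1, t.2.2, t.1) ∈ conePoints a x} c :=
    h.of_injOn (fun t => (t.2.1, t.2.2, t.1)) (fun t ht => ht) fun t _ t' _ heq => by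
      simp only [Prod.mk.injEq] at heq
      exact Prod.ext heq.2.2 (Prod.ext heq.1 heq.2.1)
  have hrot' : HasCardLE {t : ℤ × ℤ × ℤ | (t.2.2, t.1, t.2.1) ∈ conePoints a x} c :=
    h.of_injOn (fun t => (t.2.2, t.1, t.2.1)) (fun t ht => ht) fun t _ t' _ heq => by
      simp only [Prod.mk.injEq] at heq
      exact Prod.ext heq.2.1 (Prod.ext heq.2.2 heq.1)
  refine (((h.union hrot).union hrot').of_injOn
    (fun t => (D * t.1 + (a + 1) * t.2.1, D * t.2.2 - (a + 2) * t.2.1, t.2.1)) ?_ ?_).mono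
      (by linarith)
  · rintro ⟨m, w, o⟩ ⟨hw, hp, hq, hN⟩
    simp only [← hD] at hw hp hq hN ⊢
    obtain ⟨p, hp'⟩ : ∃ p, p = D * m + (a + 1) * w := ⟨_, rfl⟩
    obtain ⟨q, hq'⟩ : ∃ q, q = D * o - (a + 2) * w := ⟨_, rfl⟩
    rw [← hp'] at hp ⊢
    rw [← hq'] at hq ⊢
    have hF := simplestCubicNormForm_cone a m w o p q (by rw [hp', hD]) (by rw [hq', hD])
    rw [← hD] at hF
    have c1 : D ∣ q - (a + 1) * p := ⟨o - (a + 1) * m - w, by rw [hq', hp', hD]; ring⟩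
    have c2 : D ∣ w - (a + 1) * q := ⟨w - (a + 1) * o, by rw [hq', hD]; ring⟩
    have c3 : D ∣ p - (a + 1) * w := ⟨m, by rw [hp']; ring⟩
    have hNx : ((D ^ 3 * simplestCubicNormForm a m w o : ℤ) : ℝ) ≤ (D : ℝ) ^ 3 * x := by
      push_cast
      gcongr
    rw [hF] at hNx
    have hbound : ∀ u v z : ℤ, 1 ≤ u → 1 ≤ v → 1 ≤ z →
        p ^ 3 + q ^ 3 + w ^ 3 + (a ^ 2 + 2 * a + 6) * (p ^ 2 * q + q ^ 2 * w + w ^ 2 * p)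
          + (a ^ 2 + 4 * a + 9) * (p * q ^ 2 + q * w ^ 2 + w * p ^ 2)
          + (a ^ 4 + 6 * a ^ 3 + 21 * a ^ 2 + 36 * a + 33) * (p * q * w) =
        u ^ 3 + v ^ 3 + z ^ 3 + (a ^ 2 + 2 * a + 6) * (u ^ 2 * v + v ^ 2 * z + z ^ 2 * u)
          + (a ^ 2 + 4 * a + 9) * (u * v ^ 2 + v * z ^ 2 + z * u ^ 2)
          + (a ^ 4 + 6 * a ^ 3 + 21 * a ^ 2 + 36 * a + 33) * (u * v * z) →
        (z : ℝ) * (a ^ 2 * u + z) * (a ^ 2 * v + z) ≤ ((a : ℝ) ^ 2 + 3 * a + 3) ^ 3 * x := by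
      intro u v z hu hv hz heq
      rw [heq, hD'] at hNx
      refine le_trans ?_ hNx
      have : z * (a ^ 2 * u + z) * (a ^ 2 * v + z) ≤
        u ^ 3 + v ^ 3 + z ^ 3 + (a ^ 2 + 2 * a + 6) * (u ^ 2 * v + v ^ 2 * z + z ^ 2 * u)
          + (a ^ 2 + 4 * a + 9) * (u * v ^ 2 + v * z ^ 2 + z * u ^ 2)
          + (a ^ 4 + 6 * a ^ 3 + 21 * a ^ 2 + 36 * a + 33) * (u * v * z) := by
        rw [← sub_nonneg]
        have : 0 ≤ u ^ 3 + v ^ 3 + (a ^ 2 + 2 * a + 6) * (u ^ 2 * v + v ^ 2 * z)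
          + (2 * a + 6) * (z ^ 2 * u) + (4 * a + 9) * (v * z ^ 2)
          + (a ^ 2 + 4 * a + 9) * (u * v ^ 2 + z * u ^ 2)
          + (6 * a ^ 3 + 21 * a ^ 2 + 36 * a + 33) * (u * v * z) := by positivity
        linarith
      exact_mod_cast this
    have hp1 : 1 ≤ p := hp
    have hq1 : 1 ≤ q := hq
    rcases le_total p w with hpw | hpw
    · rcases le_total q w with hqw | hqw
      · exact Or.inl (Or.inl ⟨hp1, hq1, hw, hD ▸ c1, hD ▸ c2, hpw, hqw,
          hbound p q w hp1 hq1 hw rfl⟩)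
      · exact Or.inr ⟨hw, hp1, hq1, hD ▸ c3, hD ▸ c1, hqw, hpw.trans hqw,
          hbound w p q hw hp1 hq1 (by ring)⟩
    · rcases le_total q p with hqp | hqp
      · exact Or.inl (Or.inr ⟨hq1, hw, hp1, hD ▸ c2, hD ▸ c3, hqp, hpw,
          hbound q w p hq1 hw hp1 (by ring)⟩)
      · exact Or.inr ⟨hw, hp1, hq1, hD ▸ c3, hD ▸ c1, hpw.trans hqp, hqp,
          hbound w p q hw hp1 hq1 (by ring)⟩
  · rintro ⟨m, w, o⟩ - ⟨m', w', o'⟩ - heq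
    simp only [Prod.mk.injEq] at heq ⊢
    obtain ⟨h1, h2, rfl⟩ := heq
    exact ⟨mul_left_cancel₀ hD0.ne' (by linarith), rfl, mul_left_cancel₀ hD0.ne' (by linarith)⟩

theorem stmt_8 :
    ∀ r : ℝ, 0 < r →
    ∃ C : ℝ, 0 < C ∧
      ∀ (a : ℤ), 8 ≤ a →
      ∀ (K : Type) [Field K] [NumberField K] (σ : K →+* ℝ) (ρK : K),
        σ ρK = simplestCubicRoot a →
        IntermediateField.adjoin ℚ {ρK} = ⊤ →
        ∀ x : ℝ, 1 ≤ x → x ≤ (a : ℝ) ^ r →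
          (Set.ncard {t : ℤ × ℤ × ℤ | 1 ≤ t.2.1 ∧
              0 < (a ^ 2 + 3 * a + 3) * t.1 + (a + 1) * t.2.1 ∧
              0 < (a ^ 2 + 3 * a + 3) * t.2.2 - (a + 2) * t.2.1 ∧
              ((Algebra.norm ℚ ((t.1 : K) - (t.2.1 : K) * ρK + (t.2.2 : K) * ρK ^ 2) : ℚ) : ℝ)
                ≤ x} : ℝ) ≤
            C * ((Real.log a) ^ 2 * x / (a : ℝ) ^ 2 + (x / a) ^ ((2 : ℝ) / 3)) := by
  intro r hr
  refine ⟨1944 * (7 + r) ^ 2 + 1296, by positivity, ?_⟩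
  intro a ha K _ _ σ ρ hσ htop x hx1 hxr
  have ha' : (8 : ℝ) ≤ a := by exact_mod_cast ha
  have hρ : ρ ^ 3 - (a : K) * ρ ^ 2 - ((a : K) + 3) * ρ - 1 = 0 := by
    refine σ.injective ?_
    simpa [hσ, map_ofNat σ 3] using simplestCubicRoot_isRoot ha
  simp only [norm_eq_simplestCubicNormForm a hρ htop, Rat.cast_intCast]
  have hlog : 1 ≤ Real.log a := by
    rw [Real.le_log_iff_exp_le (by linarith)]
    linarith [Real.exp_one_lt_d9]
  have h216 : Real.log 216 ≤ 6 := by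
    rw [Real.log_le_iff_le_exp (by norm_num), show (6 : ℝ) = (6 : ℕ) * 1 by norm_num,
      Real.exp_nat_mul]
    refine le_trans ?_ (pow_le_pow_left₀ (by norm_num) Real.exp_one_gt_d9.le 6)
    norm_num
  have hlogx : Real.log x ≤ r * Real.log a := by
    rw [← Real.log_rpow (by linarith)]
    exact Real.log_le_log (by linarith) hxr
  have hB : 1 ≤ 2 * (108 * x) / (a : ℝ) ^ 2 →
      1 + Real.log (2 * (108 * x) / (a : ℝ) ^ 2) ≤ (7 + r) * Real.log a := fun _ => by
    have h1 : 2 * (108 * x) / (a : ℝ) ^ 2 ≤ 216 * x := by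
      rw [show 2 * (108 * x) = 216 * x by ring]
      exact div_le_self (by positivity) (by nlinarith)
    have h2 := Real.log_le_log (by positivity) h1
    rw [Real.log_mul (by norm_num) (by positivity)] at h2
    nlinarith
  have hmain := (hasCardLE_normBounded ha
    (hasCardLE_conePoints ha (hasCardLE_latticePoints ha (by positivity) hB))).2
  refine hmain.trans ?_
  have hpow : (108 * x / (a : ℝ)) ^ ((2 : ℝ) / 3) ≤ 108 * (x / a) ^ ((2 : ℝ) / 3) := by
    rw [mul_div_assoc, Real.mul_rpow (by norm_num) (by positivity)]
    gcongr
    exact Real.rpow_le_self_of_one_le (by norm_num) (by norm_num)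
  have hL : 0 ≤ (Real.log a) ^ 2 * x / (a : ℝ) ^ 2 := by positivity
  have hE : 0 ≤ (x / a) ^ ((2 : ℝ) / 3) := by positivity
  have heq : 3 * (2 * (108 * x) / (a : ℝ) ^ 2 * ((7 + r) * Real.log a) ^ 2) =
      648 * (7 + r) ^ 2 * ((Real.log a) ^ 2 * x / (a : ℝ) ^ 2) := by ring
  rw [heq]
  have : 0 ≤ (7 + r) ^ 2 * (x / a) ^ ((2 : ℝ) / 3) := by positivity
  linarith
end

section
/- For every real r > 0 there exists a constant C_r > 0 such that for every integer a ≥ 8 and every real number x with 1 ≤ x ≤ a^r, the number of pairs of integers (m, w) with w ≥ 1, m ≥ ⌊−(a+1)·w/(a² + 3a + 3)⌋ + 2 and Nm(m − w·ρ + (⌊(a+2)·w/(a² + 3a + 3)⌋ + 1)·ρ²) ≤ x is at most C_r·((log a)²·x/a² + (x/a)^(2/3)). -/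
open NumberField

open Real in
theorem ncard_triple_prod_le {Z W : ℝ} (hZW : Z ≤ W) (hW : 1 ≤ W) :
    {p : ℕ × ℕ × ℕ | 1 ≤ p.1 ∧ 1 ≤ p.2.1 ∧ 1 ≤ p.2.2 ∧
      (p.1 : ℝ) * p.2.1 * p.2.2 ≤ Z}.Finite ∧
    ({p : ℕ × ℕ × ℕ | 1 ≤ p.1 ∧ 1 ≤ p.2.1 ∧ 1 ≤ p.2.2 ∧
      (p.1 : ℝ) * p.2.1 * p.2.2 ≤ Z}.ncard : ℝ) ≤ |Z| * (1 + log W) ^ 2 := by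
  set P := ⌊W⌋₊ with hP
  set F : Finset (ℕ × ℕ × ℕ) := (Finset.Icc 1 P ×ˢ Finset.Icc 1 P).biUnion
    (fun q => (Finset.Icc 1 ⌊Z / ((q.1 : ℝ) * q.2)⌋₊).image (fun k => (k, q.1, q.2))) with hF
  have hsub : {p : ℕ × ℕ × ℕ | 1 ≤ p.1 ∧ 1 ≤ p.2.1 ∧ 1 ≤ p.2.2 ∧
      (p.1 : ℝ) * p.2.1 * p.2.2 ≤ Z} ⊆ (F : Set (ℕ × ℕ × ℕ)) := by
    rintro ⟨k, p, q⟩ ⟨hk, hp, hq, h⟩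
    simp only at hk hp hq h
    have hk' : (1 : ℝ) ≤ k := by exact_mod_cast hk
    have hp' : (1 : ℝ) ≤ p := by exact_mod_cast hp
    have hq' : (1 : ℝ) ≤ q := by exact_mod_cast hq
    have hkp : (p : ℝ) ≤ k * p := by nlinarith
    have hkp1 : 1 ≤ (k : ℝ) * p := by linarith
    have h1 : (k : ℝ) * p ≤ k * p * q := by nlinarith
    have h2 : (q : ℝ) ≤ k * p * q := by nlinarith
    simp only [hF, Finset.coe_biUnion, Set.mem_iUnion, Finset.coe_image, Set.mem_image]
    refine ⟨(p, q), ?_, k, ?_, rfl⟩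
    · simp only [Finset.coe_product, Finset.coe_Icc, Set.mem_prod, Set.mem_Icc]
      exact ⟨⟨hp, Nat.le_floor (by linarith)⟩, hq, Nat.le_floor (by linarith)⟩
    · simp only [Finset.coe_Icc, Set.mem_Icc]
      refine ⟨hk, Nat.le_floor ?_⟩
      rw [le_div_iff₀ (by positivity)]
      linarith
  refine ⟨F.finite_toSet.subset hsub, ?_⟩
  have hH : ∑ p ∈ Finset.Icc 1 P, ((p : ℝ))⁻¹ ≤ 1 + log W := by
    have h1 := harmonic_le_one_add_log P
    rw [harmonic_eq_sum_Icc] at h1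
    push_cast at h1
    have hP1 : 1 ≤ P := Nat.le_floor (by simpa using hW)
    have h2 : log P ≤ log W :=
      log_le_log (by exact_mod_cast hP1) (Nat.floor_le (by linarith))
    linarith
  have hH0 : 0 ≤ ∑ p ∈ Finset.Icc 1 P, ((p : ℝ))⁻¹ := Finset.sum_nonneg fun _ _ => by positivity
  calc ((Set.ncard _ : ℕ) : ℝ) ≤ (F.card : ℝ) := by
        exact_mod_cast (Set.ncard_le_ncard hsub F.finite_toSet).trans (Set.ncard_coe_finset F).le
    _ ≤ ∑ q ∈ Finset.Icc 1 P ×ˢ Finset.Icc 1 P,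
          (((Finset.Icc 1 ⌊Z / ((q.1 : ℝ) * q.2)⌋₊).image (fun k => (k, q.1, q.2))).card : ℝ) := by
        rw [← Nat.cast_sum]; exact Nat.cast_le.2 Finset.card_biUnion_le
    _ ≤ ∑ q ∈ Finset.Icc 1 P ×ˢ Finset.Icc 1 P, |Z| * ((q.1 : ℝ)⁻¹ * (q.2 : ℝ)⁻¹) := by
        refine Finset.sum_le_sum fun q _ => ?_
        refine (Nat.cast_le.2 Finset.card_image_le).trans ?_
        rw [Nat.card_Icc, Nat.add_sub_cancel, ← mul_inv, ← div_eq_mul_inv]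
        calc ((⌊Z / ((q.1 : ℝ) * q.2)⌋₊ : ℕ) : ℝ) ≤ (⌊|Z| / (q.1 * q.2)⌋₊ : ℕ) := by
              exact_mod_cast Nat.floor_le_floor (by gcongr; exact le_abs_self Z)
          _ ≤ _ := Nat.floor_le (by positivity)
    _ = |Z| * (∑ p ∈ Finset.Icc 1 P, ((p : ℝ))⁻¹) ^ 2 := by
        rw [← Finset.mul_sum, sq, Finset.sum_mul_sum, Finset.sum_product]
    _ ≤ _ := by gcongr

theorem sum_Icc_inv_sqrt_le (n : ℕ) :
    ∑ p ∈ Finset.Icc 1 n, (√(p : ℝ))⁻¹ ≤ 2 * √(n : ℝ) := by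
  induction n with
  | zero => simp
  | succ n ih =>
    rw [Finset.sum_Icc_succ_top (by omega)]
    have h0 : 0 < √((n + 1 : ℕ) : ℝ) := Real.sqrt_pos.2 (by positivity)
    have h1 : √((n + 1 : ℕ) : ℝ) ^ 2 = n + 1 := by
      rw [Real.sq_sqrt (by positivity)]; push_cast; rfl
    have h2 : √(n : ℝ) ^ 2 = n := Real.sq_sqrt (by positivity)
    have h4 : (√((n + 1 : ℕ) : ℝ))⁻¹ ≤ 2 * √((n + 1 : ℕ) : ℝ) - 2 * √(n : ℝ) := by
      rw [inv_le_iff_one_le_mul₀ h0]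
      nlinarith [sq_nonneg (√((n + 1 : ℕ) : ℝ) - √(n : ℝ))]
    linarith

theorem ncard_mul_sq_le {Y : ℝ} (hY : 0 ≤ Y) :
    {p : ℕ × ℕ | 1 ≤ p.1 ∧ p.1 ≤ p.2 ∧ (p.1 : ℝ) * p.2 ^ 2 ≤ Y}.Finite ∧
    ({p : ℕ × ℕ | 1 ≤ p.1 ∧ p.1 ≤ p.2 ∧ (p.1 : ℝ) * p.2 ^ 2 ≤ Y}.ncard : ℝ) ≤
      2 * Y ^ ((2 : ℝ) / 3) := by
  set n := ⌊Y ^ ((1 : ℝ) / 3)⌋₊ with hn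
  set F : Finset (ℕ × ℕ) := (Finset.Icc 1 n).biUnion
    (fun p => (Finset.Icc 1 ⌊√(Y / p)⌋₊).image (fun q => (p, q))) with hF
  have hsub : {p : ℕ × ℕ | 1 ≤ p.1 ∧ p.1 ≤ p.2 ∧ (p.1 : ℝ) * p.2 ^ 2 ≤ Y} ⊆
      (F : Set (ℕ × ℕ)) := by
    rintro ⟨p, q⟩ ⟨hp, hpq, h⟩
    simp only at hp hpq h
    have hp' : (1 : ℝ) ≤ p := by exact_mod_cast hp
    have hq' : (p : ℝ) ≤ q := by exact_mod_cast hpq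
    simp only [hF, Finset.coe_biUnion, Set.mem_iUnion, Finset.coe_image, Set.mem_image]
    refine ⟨p, ?_, q, ?_, rfl⟩
    · simp only [Finset.coe_Icc, Set.mem_Icc]
      refine ⟨hp, Nat.le_floor ?_⟩
      have h3 : (p : ℝ) ^ 3 ≤ Y := by
        calc (p : ℝ) ^ 3 = (p : ℝ) * (p : ℝ) ^ 2 := by ring
          _ ≤ (p : ℝ) * (q : ℝ) ^ 2 := by gcongr
          _ ≤ Y := h
      calc (p : ℝ) = ((p : ℝ) ^ 3) ^ ((1 : ℝ) / 3) := by
            rw [← Real.rpow_natCast, ← Real.rpow_mul (by positivity)]; norm_num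
        _ ≤ _ := by gcongr
    · simp only [Finset.coe_Icc, Set.mem_Icc]
      refine ⟨hp.trans hpq, Nat.le_floor ?_⟩
      apply Real.le_sqrt_of_sq_le
      rw [le_div_iff₀ (by positivity)]
      linarith
  refine ⟨F.finite_toSet.subset hsub, ?_⟩
  calc ((Set.ncard _ : ℕ) : ℝ) ≤ (F.card : ℝ) := by
        exact_mod_cast (Set.ncard_le_ncard hsub F.finite_toSet).trans (Set.ncard_coe_finset F).le
    _ ≤ ∑ p ∈ Finset.Icc 1 n,
          (((Finset.Icc 1 ⌊√(Y / p)⌋₊).image (fun q => (p, q))).card : ℝ) := by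
        rw [← Nat.cast_sum]; exact Nat.cast_le.2 Finset.card_biUnion_le
    _ ≤ ∑ p ∈ Finset.Icc 1 n, √Y * (√(p : ℝ))⁻¹ := by
        refine Finset.sum_le_sum fun q _ => ?_
        refine (Nat.cast_le.2 Finset.card_image_le).trans ?_
        rw [Nat.card_Icc, Nat.add_sub_cancel, ← div_eq_mul_inv, ← Real.sqrt_div hY]
        exact Nat.floor_le (by positivity)
    _ ≤ √Y * (2 * √(n : ℝ)) := by
        rw [← Finset.mul_sum]; gcongr; exact sum_Icc_inv_sqrt_le n
    _ ≤ √Y * (2 * √(Y ^ ((1 : ℝ) / 3))) := by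
        gcongr; exact Nat.floor_le (by positivity)
    _ = 2 * Y ^ ((2 : ℝ) / 3) := by
        rw [Real.sqrt_eq_rpow, Real.sqrt_eq_rpow, ← Real.rpow_mul hY]
        rw [mul_left_comm, ← Real.rpow_add_of_nonneg hY (by norm_num) (by norm_num)]
        norm_num

theorem ncard_mul_mul_add_le {Y : ℝ} (hY : 0 ≤ Y) :
    {p : ℕ × ℕ | 1 ≤ p.1 ∧ 1 ≤ p.2 ∧ (p.1 : ℝ) * p.2 * (p.1 + p.2) ≤ Y}.Finite ∧
    ({p : ℕ × ℕ | 1 ≤ p.1 ∧ 1 ≤ p.2 ∧ (p.1 : ℝ) * p.2 * (p.1 + p.2) ≤ Y}.ncard : ℝ) ≤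
      4 * Y ^ ((2 : ℝ) / 3) := by
  obtain ⟨hfin, hcard⟩ := ncard_mul_sq_le hY
  set T := {p : ℕ × ℕ | 1 ≤ p.1 ∧ p.1 ≤ p.2 ∧ (p.1 : ℝ) * p.2 ^ 2 ≤ Y}
  have hsub : {p : ℕ × ℕ | 1 ≤ p.1 ∧ 1 ≤ p.2 ∧ (p.1 : ℝ) * p.2 * (p.1 + p.2) ≤ Y} ⊆
      T ∪ Prod.swap '' T := by
    rintro ⟨p, q⟩ ⟨hp, hq, h⟩
    simp only at hp hq h
    have hp0 : (0 : ℝ) ≤ p := by positivity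
    have hq0 : (0 : ℝ) ≤ q := by positivity
    have h1 : 0 ≤ (p : ℝ) * p * q := by positivity
    have h2 : 0 ≤ (p : ℝ) * q * q := by positivity
    rcases le_total p q with hpq | hpq
    · exact Or.inl ⟨hp, hpq, by simp only; nlinarith⟩
    · exact Or.inr ⟨(q, p), ⟨hq, hpq, by simp only; nlinarith⟩, rfl⟩
  have hfin' : (T ∪ Prod.swap '' T).Finite := hfin.union (hfin.image _)
  refine ⟨hfin'.subset hsub, ?_⟩
  have h1 := (Set.ncard_le_ncard hsub hfin').trans (Set.ncard_union_le _ _)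
  have h2 := Set.ncard_image_le (f := Prod.swap) hfin
  have h3 := h1.trans (Nat.add_le_add_left h2 T.ncard)
  rw [← Nat.cast_le (α := ℝ), Nat.cast_add] at h3
  linarith

section

open Polynomial

theorem norm_aeval_eq_prod_of_roots {K : Type*} [Field K] [NumberField K] (θ : K)
    (hθ : IntermediateField.adjoin ℚ {θ} = ⊤) (g : ℚ[X]) (s : Finset ℂ)
    (hs : ∀ z : ℂ, z ∈ s ↔ aeval z (minpoly ℚ θ) = 0) :
    ((Algebra.norm ℚ (aeval θ g) : ℚ) : ℂ) = ∏ z ∈ s, aeval z g := by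
  classical
  have hint : IsIntegral ℚ θ := Algebra.IsIntegral.isIntegral θ
  have hadj : Algebra.adjoin ℚ {θ} = ⊤ := IntermediateField.adjoin_eq_top_iff.1 hθ
  let pb := PowerBasis.ofAdjoinEqTop hint hadj
  have hgen : pb.gen = θ := PowerBasis.ofAdjoinEqTop_gen hint hadj
  have h := Algebra.norm_eq_prod_embeddings ℚ ℂ (aeval θ g)
  rw [eq_ratCast] at h
  rw [h]
  have hroot : ∀ φ : K →ₐ[ℚ] ℂ, aeval (φ θ) (minpoly ℚ θ) = 0 := fun φ => by
    rw [aeval_algHom_apply, minpoly.aeval, map_zero]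
  refine Finset.prod_bij (fun φ _ => φ θ) (fun φ _ => (hs _).2 (hroot φ)) ?_ ?_ ?_
  · intro φ _ ψ _ hφψ
    exact pb.algHom_ext (by simpa [hgen] using hφψ)
  · intro z hz
    have hz' : aeval z (minpoly ℚ pb.gen) = 0 := by rw [hgen]; exact (hs z).1 hz
    refine ⟨pb.lift z hz', Finset.mem_univ _, ?_⟩
    rw [← hgen]; exact pb.lift_gen z hz'
  · intro φ _
    rw [aeval_algHom_apply]

theorem irreducible_simplestCubic {a : ℤ} (ha : 8 ≤ a) :
    Irreducible (X ^ 3 - C (a : ℚ) * X ^ 2 - C ((a : ℚ) + 3) * X - 1 : ℚ[X]) := by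
  have hdeg : (X ^ 3 - C (a : ℚ) * X ^ 2 - C ((a : ℚ) + 3) * X - 1 : ℚ[X]).natDegree = 3 := by
    compute_degree!
  rw [irreducible_iff_roots_eq_zero_of_degree_le_three (by omega) (by omega),
    Multiset.eq_zero_iff_forall_notMem]
  intro q hq
  have hq0 := (mem_roots'.1 hq).2
  simp only [IsRoot.def, eval_sub, eval_mul, eval_pow, eval_X, eval_C, eval_one] at hq0
  have hmon : (X ^ 3 - C a * X ^ 2 - C (a + 3) * X - 1 : ℤ[X]).Monic := by monicity!
  have haev : aeval q (X ^ 3 - C a * X ^ 2 - C (a + 3) * X - 1 : ℤ[X]) = 0 := by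
    simp only [map_sub, map_mul, map_pow, aeval_X, aeval_C, map_one,
      algebraMap_int_eq, Int.coe_castRingHom]
    push_cast
    exact hq0
  obtain ⟨n, rfl⟩ := isInteger_of_is_root_of_monic hmon haev
  simp only [eq_intCast] at hq0
  have h1 : n * (n ^ 2 - a * n - (a + 3)) = 1 := by
    have h2 : (n : ℚ) * (n ^ 2 - a * n - (a + 3)) = 1 := by linarith
    exact_mod_cast h2
  rcases Int.isUnit_iff.1 (IsUnit.of_mul_eq_one _ h1) with rfl | rfl <;> linarith

theorem exists_root_simplestCubic {a : ℝ} (ha : 8 ≤ a) :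
    ∃ x : ℝ, a + 1 + 2 / (a + 2) ≤ x ∧ x ^ 3 - a * x ^ 2 - (a + 3) * x - 1 = 0 := by
  let f : ℝ → ℝ := fun x => x ^ 3 - a * x ^ 2 - (a + 3) * x - 1
  have ht : 2 / (a + 2) * (a + 2) = 2 := div_mul_cancel₀ _ (by linarith)
  have ht0 : 0 < 2 / (a + 2) := by positivity
  set t := 2 / (a + 2)
  have ht1 : t ≤ 1 := by nlinarith
  have hlo : f (a + 1 + t) ≤ 0 := by
    have h1 : f (a + 1 + t) = (a + 1 + t) * (t * (a + 2) - 2 + t ^ 2) - 1 := by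
      simp only [f]; ring
    rw [h1, ht]
    nlinarith
  have hhi : 0 ≤ f (a + 2) := by simp only [f]; nlinarith
  have hc : ContinuousOn f (Set.Icc (a + 1 + t) (a + 2)) := by fun_prop
  obtain ⟨x, hx, hx0⟩ := intermediate_value_Icc (by linarith) hc ⟨hlo, hhi⟩
  exact ⟨x, hx.1, hx0⟩

theorem simplestCubicRoot_spec {a : ℤ} (ha : 8 ≤ a) :
    (a : ℝ) + 1 + 2 / (a + 2) ≤ simplestCubicRoot a ∧
      simplestCubicRoot a ^ 3 - (a : ℝ) * simplestCubicRoot a ^ 2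
        - ((a : ℝ) + 3) * simplestCubicRoot a - 1 = 0 := by
  have ha' : (8 : ℝ) ≤ a := by exact_mod_cast ha
  obtain ⟨x, hx, hx0⟩ := exists_root_simplestCubic ha'
  have hbdd : BddAbove {x : ℝ | x ^ 3 - (a : ℝ) * x ^ 2 - ((a : ℝ) + 3) * x - 1 = 0} := by
    refine ⟨a + 2, fun y hy => ?_⟩
    by_contra! h
    have hy' : y ^ 3 - (a : ℝ) * y ^ 2 - ((a : ℝ) + 3) * y - 1 = 0 := hy
    have h1 : 0 < (y - (a + 2)) * y ^ 2 := mul_pos (by linarith) (by nlinarith)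
    nlinarith
  have hclosed : IsClosed {x : ℝ | x ^ 3 - (a : ℝ) * x ^ 2 - ((a : ℝ) + 3) * x - 1 = 0} :=
    isClosed_eq (by fun_prop) continuous_const
  exact ⟨hx.trans (le_csSup hbdd hx0), hclosed.csSup_mem ⟨x, hx0⟩ hbdd⟩

/-- The cone element `(a+2)X² - DX - (a+1)`, with `D = a² + 3a + 3`, at the three roots. -/
theorem cone_generator_bounds {a y : ℝ} (ha : 8 ≤ a) (hy : a + 1 + 2 / (a + 2) ≤ y)
    (hy0 : y ^ 3 - a * y ^ 2 - (a + 3) * y - 1 = 0) :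
    0 ≤ (a + 2) * y ^ 2 - (a ^ 2 + 3 * a + 3) * y - (a + 1) ∧
    a ^ 2 + 3 * a + 3 ≤ (a + 2) * (-1 - 1 / y) ^ 2 - (a ^ 2 + 3 * a + 3) * (-1 - 1 / y) - (a + 1) ∧
    0 ≤ (a + 2) * (-1 / (1 + y)) ^ 2 - (a ^ 2 + 3 * a + 3) * (-1 / (1 + y)) - (a + 1) := by
  have ht : 2 / (a + 2) * (a + 2) = 2 := div_mul_cancel₀ _ (by linarith)
  have ht0 : 0 < 2 / (a + 2) := by positivity
  obtain ⟨t, rfl⟩ : ∃ t, y = a + 1 + t := ⟨y - a - 1, by ring⟩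
  have htt : 2 ≤ t * (a + 2) := by
    calc 2 = 2 / (a + 2) * (a + 2) := ht.symm
      _ ≤ t * (a + 2) := by gcongr; linarith
  have htpos : 0 < t := by linarith
  have hkey : (a + 1 + t) * (t * (a + 2) - 2 + t ^ 2) = 1 := by linarith
  refine ⟨?_, ?_, ?_⟩
  · have : (a + 2) * (a + 1 + t) ^ 2 - (a ^ 2 + 3 * a + 3) * (a + 1 + t) - (a + 1)
        = (a + 1) * (t * (a + 2) - 2) + t * (t * (a + 2) - 1) := by ring
    rw [this]
    have h1 : 0 ≤ (a + 1) * (t * (a + 2) - 2) := mul_nonneg (by linarith) (by linarith)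
    have h2 : 0 ≤ t * (t * (a + 2) - 1) := mul_nonneg (by linarith) (by linarith)
    linarith
  · have h1 : 0 < 1 / (a + 1 + t) := by positivity
    set u := 1 / (a + 1 + t)
    have h2 : 0 < (a + 2) * u := by positivity
    have h3 : 0 < (a + 2) * u ^ 2 := by positivity
    have h4 : 0 < (a ^ 2 + 3 * a + 3) * u := by positivity
    linarith
  · have hne : 1 + (a + 1 + t) ≠ 0 := by positivity
    have h1 : (a + 2) * (-1 / (1 + (a + 1 + t))) ^ 2
        - (a ^ 2 + 3 * a + 3) * (-1 / (1 + (a + 1 + t))) - (a + 1)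
        = ((a + 2) + (a + 2 + t) * (1 - (a + 1) * t)) / (1 + (a + 1 + t)) ^ 2 := by
      field_simp; ring
    rw [h1]
    apply div_nonneg _ (by positivity)
    obtain ⟨e, he⟩ : ∃ e, e = t * (a + 2) - 2 + t ^ 2 := ⟨_, rfl⟩
    rw [← he] at hkey
    have he0 : 0 ≤ e := by nlinarith
    have h2 : (a + 2) + (a + 2 + t) * (1 - (a + 1) * t) = 1 + t + t * e := by
      linear_combination (a + 1) * he - hkey
    rw [h2]
    positivity

theorem norm_eq_prod_simplestCubic {a : ℤ} (ha : 8 ≤ a) {K : Type} [Field K] [NumberField K]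
    (σ : K →+* ℝ) {ρ : K} (hσ : σ ρ = simplestCubicRoot a)
    (hρ : IntermediateField.adjoin ℚ {ρ} = ⊤) (m w v : ℤ) :
    ((Algebra.norm ℚ ((m : K) - (w : K) * ρ + (v : K) * ρ ^ 2) : ℚ) : ℝ) =
      ∏ z ∈ {simplestCubicRoot a, -1 - 1 / simplestCubicRoot a, -1 / (1 + simplestCubicRoot a)},
        ((m : ℝ) - w * z + v * z ^ 2) := by
  classical
  obtain ⟨hy, hy0⟩ := simplestCubicRoot_spec ha
  have ha' : (8 : ℝ) ≤ a := by exact_mod_cast ha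
  set y := simplestCubicRoot a with hydef
  have hypos : 0 < y := by
    have : (0 : ℝ) < 2 / (a + 2) := by positivity
    linarith
  have hroot : aeval ρ (X ^ 3 - C (a : ℚ) * X ^ 2 - C ((a : ℚ) + 3) * X - 1 : ℚ[X]) = 0 := by
    apply σ.injective
    simp only [map_sub, map_mul, map_pow, aeval_X, map_one, map_zero, map_add, hσ,
      map_ofNat, map_intCast]
    exact hy0
  have hmin : minpoly ℚ ρ = X ^ 3 - C (a : ℚ) * X ^ 2 - C ((a : ℚ) + 3) * X - 1 :=
    (minpoly.eq_of_irreducible_of_monic (irreducible_simplestCubic ha) hroot (by monicity!)).symm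
  have hs : ∀ z : ℂ, z ∈ (({y, -1 - 1 / y, -1 / (1 + y)} : Finset ℝ).image ((↑) : ℝ → ℂ)) ↔
      aeval z (minpoly ℚ ρ) = 0 := by
    intro z
    have hy1 : (y : ℂ) ≠ 0 := by exact_mod_cast hypos.ne'
    have hy2 : (1 : ℂ) + y ≠ 0 := by exact_mod_cast (by positivity : 1 + y ≠ 0)
    have hyc : (y : ℂ) ^ 3 - a * y ^ 2 - (a + 3) * y - 1 = 0 := by exact_mod_cast hy0
    have hac : (a : ℂ) = (y ^ 3 - 3 * y - 1) / (y * (1 + y)) := by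
      rw [eq_div_iff (mul_ne_zero hy1 hy2)]
      linear_combination -hyc
    have hfac : z ^ 3 - a * z ^ 2 - (a + 3) * z - 1 =
        (z - y) * (z - (-1 - 1 / y)) * (z - (-1 / (1 + y))) := by
      rw [hac]; field_simp; ring
    rw [hmin]
    simp only [map_sub, map_mul, map_pow, aeval_X, map_one, map_add,
      map_ofNat, map_intCast]
    rw [hfac]
    simp [sub_eq_zero, or_assoc]
  have h := norm_aeval_eq_prod_of_roots ρ hρ
    (C (m : ℚ) - C (w : ℚ) * X + C (v : ℚ) * X ^ 2) _ hs
  rw [Finset.prod_image (fun _ _ _ _ h => Complex.ofReal_injective h)] at h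
  simp only [map_sub, map_mul, map_pow, aeval_X, map_add, map_intCast] at h
  exact_mod_cast h

theorem le_norm_simplestCubic {a : ℤ} (ha : 8 ≤ a) {K : Type} [Field K] [NumberField K]
    (σ : K →+* ℝ) {ρ : K} (hσ : σ ρ = simplestCubicRoot a)
    (hρ : IntermediateField.adjoin ℚ {ρ} = ⊤) {m w v : ℤ} {k s : ℝ} (hk : 0 ≤ k)
    (hw : 0 ≤ w) (hs0 : 0 ≤ s) (hs : s = ((a : ℝ) ^ 2 + 3 * a + 3) * v - (a + 2) * w)
    (hm : k * ((a : ℝ) ^ 2 + 3 * a + 3) ≤ m * ((a : ℝ) ^ 2 + 3 * a + 3) + (a + 1) * w) :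
    (k + s) * (k + w) * k ≤
      2 * ((Algebra.norm ℚ ((m : K) - (w : K) * ρ + (v : K) * ρ ^ 2) : ℚ) : ℝ) := by
  rw [norm_eq_prod_simplestCubic ha σ hσ hρ]
  obtain ⟨hy, hy0⟩ := simplestCubicRoot_spec ha
  have ha' : (8 : ℝ) ≤ a := by exact_mod_cast ha
  have hw' : (0 : ℝ) ≤ w := by exact_mod_cast hw
  obtain ⟨h1, h2, h3⟩ := cone_generator_bounds ha' hy hy0
  set y := simplestCubicRoot a
  set D : ℝ := (a : ℝ) ^ 2 + 3 * a + 3 with hD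
  have hDpos : 0 < D := by positivity
  have hya : (a : ℝ) ≤ y := by
    have : (0 : ℝ) < 2 / (a + 2) := by positivity
    linarith
  have hypos : 0 < y := by linarith
  have hz2 : -1 - 1 / y < -1 := by
    have : 0 < 1 / y := by positivity
    linarith
  have hz3 : -1 < -1 / (1 + y) := by
    rw [lt_div_iff₀ (by linarith)]; linarith
  have hz3' : -1 / (1 + y) < 0 := div_neg_of_neg_of_pos (by norm_num) (by linarith)
  have hexp : ∀ z : ℝ, D * ((m : ℝ) - w * z + v * z ^ 2) =
      (m * D + (a + 1) * w) + s * z ^ 2 + w * ((a + 2) * z ^ 2 - D * z - (a + 1)) := by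
    intro z; rw [hs]; ring
  have hg1 : (k + s) / 2 ≤ (m : ℝ) - w * y + v * y ^ 2 := by
    have h4 : D ≤ 2 * y ^ 2 := by nlinarith
    have h5 : s * D ≤ s * (2 * y ^ 2) := by gcongr
    have h6 := mul_nonneg hw' h1
    have h7 := hexp y
    have h8 := mul_nonneg hk hDpos.le
    nlinarith
  rw [Finset.prod_insert, Finset.prod_insert, Finset.prod_singleton]
  · set z₂ := -1 - 1 / y
    set z₃ := -1 / (1 + y)
    have hg2 : k + w ≤ (m : ℝ) - w * z₂ + v * z₂ ^ 2 := by
      have h5 : 0 ≤ s * z₂ ^ 2 := by positivity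
      have h6 := mul_le_mul_of_nonneg_left h2 hw'
      have h7 := hexp z₂
      nlinarith
    have hg3 : k ≤ (m : ℝ) - w * z₃ + v * z₃ ^ 2 := by
      have h5 : 0 ≤ s * z₃ ^ 2 := by positivity
      have h6 := mul_nonneg hw' h3
      have h7 := hexp z₃
      nlinarith
    calc (k + s) * (k + w) * k = 2 * ((k + s) / 2 * ((k + w) * k)) := by ring
      _ ≤ _ := by
        gcongr
        · exact (by positivity : 0 ≤ (k + s) / 2).trans hg1
        · exact (by positivity : 0 ≤ k + w).trans hg2
  · rw [Finset.mem_singleton]; linarith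
  · simp only [Finset.mem_insert, Finset.mem_singleton, not_or]
    constructor <;> linarith

end

theorem ncard_le_of_injOn_triple {α : Type*} {U : Set α} {Z W : ℝ} (hZW : Z ≤ W) (hW : 1 ≤ W)
    (k p q : α → ℤ) (hpos : ∀ u ∈ U, 1 ≤ k u ∧ 1 ≤ p u ∧ 1 ≤ q u)
    (hprod : ∀ u ∈ U, (k u : ℝ) * p u * q u ≤ Z)
    (hinj : ∀ u ∈ U, ∀ u' ∈ U, k u = k u' → p u = p u' → q u = q u' → u = u') :
    U.Finite ∧ (U.ncard : ℝ) ≤ |Z| * (1 + Real.log W) ^ 2 := by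
  obtain ⟨hfin, hcard⟩ := ncard_triple_prod_le hZW hW
  set f : α → ℕ × ℕ × ℕ := fun u => ((k u).toNat, (p u).toNat, (q u).toNat)
  have hmaps : Set.MapsTo f U {p : ℕ × ℕ × ℕ | 1 ≤ p.1 ∧ 1 ≤ p.2.1 ∧ 1 ≤ p.2.2 ∧
      (p.1 : ℝ) * p.2.1 * p.2.2 ≤ Z} := by
    intro u hu
    obtain ⟨h1, h2, h3⟩ := hpos u hu
    refine ⟨by simp only [f]; omega, by simp only [f]; omega, by simp only [f]; omega, ?_⟩
    have hc : ∀ n : ℤ, 1 ≤ n → ((n.toNat : ℕ) : ℝ) = n := fun n hn => by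
      exact_mod_cast congrArg (Int.cast (R := ℝ)) (Int.toNat_of_nonneg (by omega : 0 ≤ n))
    simp only [f, hc _ h1, hc _ h2, hc _ h3]
    exact hprod u hu
  have hinj' : Set.InjOn f U := by
    intro u hu u' hu' h
    simp only [f, Prod.mk.injEq] at h
    have h1 := hpos u hu
    have h2 := hpos u' hu'
    exact hinj u hu u' hu' (by omega) (by omega) (by omega)
  exact ⟨Set.Finite.of_injOn hmaps hinj' hfin,
    (Nat.cast_le.2 (Set.ncard_le_ncard_of_injOn f hmaps hinj' hfin)).trans hcard⟩

theorem ncard_le_of_injOn_pair {α : Type*} {U : Set α} {Y : ℝ} (hY : 0 ≤ Y)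
    (k p : α → ℤ) (hpos : ∀ u ∈ U, 1 ≤ k u ∧ 1 ≤ p u)
    (hprod : ∀ u ∈ U, (k u : ℝ) * p u * (k u + p u) ≤ Y)
    (hinj : ∀ u ∈ U, ∀ u' ∈ U, k u = k u' → p u = p u' → u = u') :
    U.Finite ∧ (U.ncard : ℝ) ≤ 4 * Y ^ ((2 : ℝ) / 3) := by
  obtain ⟨hfin, hcard⟩ := ncard_mul_mul_add_le hY
  set f : α → ℕ × ℕ := fun u => ((k u).toNat, (p u).toNat)
  have hmaps : Set.MapsTo f U
      {p : ℕ × ℕ | 1 ≤ p.1 ∧ 1 ≤ p.2 ∧ (p.1 : ℝ) * p.2 * (p.1 + p.2) ≤ Y} := by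
    intro u hu
    obtain ⟨h1, h2⟩ := hpos u hu
    refine ⟨by simp only [f]; omega, by simp only [f]; omega, ?_⟩
    have hc : ∀ n : ℤ, 1 ≤ n → ((n.toNat : ℕ) : ℝ) = n := fun n hn => by
      exact_mod_cast congrArg (Int.cast (R := ℝ)) (Int.toNat_of_nonneg (by omega : 0 ≤ n))
    simp only [f, hc _ h1, hc _ h2]
    exact hprod u hu
  have hinj' : Set.InjOn f U := by
    intro u hu u' hu' h
    simp only [f, Prod.mk.injEq] at h
    have h1 := hpos u hu
    have h2 := hpos u' hu'
    exact hinj u hu u' hu' (by omega) (by omega)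
  exact ⟨Set.Finite.of_injOn hmaps hinj' hfin,
    (Nat.cast_le.2 (Set.ncard_le_ncard_of_injOn f hmaps hinj' hfin)).trans hcard⟩

/-- Coordinates on `w`: with `D = (A-1)A + 1` and `s = Dv - Aw ∈ [1, D]`, write
`s = b + A j` with `b ∈ [1, A]`; then `w = tD + (A-1)b - j` for some `t ≥ 0`. -/
theorem exists_digits {A v w s : ℤ} (hA : 2 ≤ A) (hw : 1 ≤ w)
    (hs : s = ((A - 1) * A + 1) * v - A * w) (hs1 : 1 ≤ s) (hsD : s ≤ (A - 1) * A + 1) :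
    ∃ b j t : ℤ, b = s - A * ((s - 1) / A) ∧ j = (s - 1) / A ∧ t = w + j - (A - 1) * v ∧
      s = b + A * j ∧ 1 ≤ b ∧ 0 ≤ j ∧ j ≤ A - 1 ∧ 0 ≤ t ∧
      w = t * ((A - 1) * A + 1) + (A - 1) * b - j := by
  refine ⟨_, _, _, rfl, rfl, rfl, by ring, ?_, ?_, ?_, ?_, ?_⟩
  · have := Int.mul_ediv_self_le (x := s - 1) (k := A) (by omega); linarith
  · exact Int.ediv_nonneg (by omega) (by omega)
  · exact Int.ediv_le_of_le_mul (by omega) (by linarith)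
  · set j := (s - 1) / A with hj
    have hlt : s - 1 < A * j + A := Int.lt_mul_ediv_self_add (by omega)
    have hv : 1 ≤ v := by
      by_contra! h
      have h1 : ((A - 1) * A + 1) * v ≤ 0 :=
        mul_nonpos_of_nonneg_of_nonpos (by nlinarith) (by omega)
      nlinarith
    have h2 : -A < A * (w + j - (A - 1) * v) := by nlinarith
    by_contra! h
    nlinarith
  · rw [hs]; ring

theorem ncard_cone_points_le {A : ℤ} (hA : 10 ≤ A) {X : ℝ} (hX : 1 ≤ X) {T : Set (ℤ × ℤ)}
    {v : ℤ → ℤ} (hT : ∀ p ∈ T, 1 ≤ p.1 ∧ 1 ≤ p.2 ∧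
      1 ≤ ((A - 1) * A + 1) * v p.2 - A * p.2 ∧
      ((A - 1) * A + 1) * v p.2 - A * p.2 ≤ (A - 1) * A + 1 ∧
      (((p.1 + (((A - 1) * A + 1) * v p.2 - A * p.2)) * (p.1 + p.2) * p.1 : ℤ) : ℝ) ≤ X) :
    (T.ncard : ℝ) ≤ 4 * (2 * X / (A * (A - 1)) * (1 + Real.log X) ^ 2) +
      4 * (X / (A - 1)) ^ ((2 : ℝ) / 3) := by
  have hA' : (10 : ℝ) ≤ A := by exact_mod_cast hA
  have hAA : (0 : ℝ) < A * (A - 1) := mul_pos (by linarith) (by linarith)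
  set s : ℤ × ℤ → ℤ := fun p => ((A - 1) * A + 1) * v p.2 - A * p.2 with hs
  set j : ℤ × ℤ → ℤ := fun p => (s p - 1) / A with hj
  set b : ℤ × ℤ → ℤ := fun p => s p - A * j p with hb
  set t : ℤ × ℤ → ℤ := fun p => p.2 + j p - (A - 1) * v p.2 with ht
  have hdig : ∀ p ∈ T, 1 ≤ p.1 ∧ 1 ≤ p.2 ∧ s p = b p + A * j p ∧ 1 ≤ b p ∧ 0 ≤ j p ∧
      j p ≤ A - 1 ∧ 0 ≤ t p ∧ p.2 = t p * ((A - 1) * A + 1) + (A - 1) * b p - j p ∧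
      (((p.1 + s p) * (p.1 + p.2) * p.1 : ℤ) : ℝ) ≤ X := by
    intro p hp
    obtain ⟨h1, h2, h3, h4, h5⟩ := hT p hp
    obtain ⟨_, _, _, rfl, rfl, rfl, h6, h7, h8, h9, h10, h11⟩ :=
      exists_digits (by omega) h2 rfl h3 h4
    exact ⟨h1, h2, h6, h7, h8, h9, h10, h11, h5⟩
  have hs1 : ∀ p ∈ T, 1 ≤ s p := fun p hp => (hT p hp).2.2.1
  have hdig_eq : ∀ p p', s p = s p' → j p = j p' ∧ b p = b p' := by
    intro p p' h
    simp only [hb, hj, h, and_self]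
  clear_value t b j s
  have hZX : 2 * X / (A * (A - 1)) ≤ X := by
    have h2 : (2 : ℝ) ≤ A * (A - 1) := by nlinarith
    rw [div_le_iff₀ hAA]; nlinarith
  have habs : |2 * X / (A * (A - 1))| = 2 * X / (A * (A - 1)) := abs_of_nonneg (by positivity)
  have hZ : ∀ u ∈ T, ∀ p q : ℤ, p * q * (A * (A - 1)) ≤ s u * (2 * u.2) →
      (u.1 : ℝ) * p * q ≤ 2 * X / (A * (A - 1)) := by
    intro u hu p q h
    obtain ⟨h1, h2, -, -, -, -, -, -, h9⟩ := hdig u hu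
    have h3 := hs1 u hu
    rw [le_div_iff₀ hAA]
    have h4 : u.1 * p * q * (A * (A - 1)) ≤ 2 * ((u.1 + s u) * (u.1 + u.2) * u.1) := by
      calc u.1 * p * q * (A * (A - 1)) = u.1 * (p * q * (A * (A - 1))) := by ring
        _ ≤ u.1 * (s u * (2 * u.2)) := by gcongr
        _ = 2 * (s u * u.2 * u.1) := by ring
        _ ≤ _ := by gcongr <;> omega
    have h5 : (u.1 : ℝ) * p * q * (A * (A - 1)) ≤
        2 * (((u.1 + s u) * (u.1 + u.2) * u.1 : ℤ) : ℝ) := by exact_mod_cast h4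
    linarith
  obtain ⟨hf₁, hc₁⟩ := ncard_le_of_injOn_pair (U := {p ∈ T | t p = 0 ∧ j p = 0})
    (Y := X / (A - 1)) (div_nonneg (by linarith) (by linarith)) (fun p => p.1) b
    (fun p hp => ⟨(hdig p hp.1).1, (hdig p hp.1).2.2.2.1⟩)
    (by
      rintro p ⟨hp, ht0, hj0⟩
      obtain ⟨h1, h2, h3, h4, h5, h6, h7, h8, h9⟩ := hdig p hp
      rw [le_div_iff₀ (by linarith)]
      refine le_trans ?_ h9
      rw [ht0, hj0] at h8
      rw [hj0] at h3
      have h10 : p.1 * b p * (p.1 + b p) * (A - 1) ≤ (p.1 + s p) * (p.1 + p.2) * p.1 := by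
        calc _ = (p.1 + s p) * p.2 * p.1 := by rw [h3, h8]; ring
          _ ≤ _ := by
            gcongr
            · omega
            · omega
      exact_mod_cast h10)
    (by
      rintro p ⟨hp, ht0, hj0⟩ p' ⟨hp', ht0', hj0'⟩ h1 h2
      refine Prod.ext h1 ?_
      rw [(hdig p hp).2.2.2.2.2.2.2.1, (hdig p' hp').2.2.2.2.2.2.2.1, ht0, ht0', hj0, hj0', h2])
  obtain ⟨hf₂, hc₂⟩ := ncard_le_of_injOn_triple
    (U := {p ∈ T | t p = 0 ∧ 1 ≤ j p ∧ b p = 1 ∧ j p ≤ p.2}) hZX hX (fun p => p.1) j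
    (fun _ => 1)
    (fun p hp => ⟨(hdig p hp.1).1, hp.2.2.1, le_rfl⟩)
    (by
      rintro p ⟨hp, ht0, hj1, hb1, hjw⟩
      obtain ⟨h1, h2, h3, h4, h5, h6, h7, h8, h9⟩ := hdig p hp
      refine hZ p hp _ _ ?_
      rw [ht0, hb1] at h8
      calc j p * 1 * (A * (A - 1)) = (A * j p) * (A - 1) := by ring
        _ ≤ _ := mul_le_mul (by omega) (by omega) (by omega) (hs1 p hp |>.trans' zero_le_one))
    (by
      rintro p ⟨hp, ht0, hj1, hb1, hjw⟩ p' ⟨hp', ht0', hj1', hb1', hjw'⟩ h1 h2 _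
      refine Prod.ext h1 ?_
      rw [(hdig p hp).2.2.2.2.2.2.2.1, (hdig p' hp').2.2.2.2.2.2.2.1, ht0, ht0', hb1, hb1', h2])
  obtain ⟨hf₃, hc₃⟩ := ncard_le_of_injOn_triple
    (U := {p ∈ T | t p = 0 ∧ 1 ≤ j p ∧ b p = 1 ∧ p.2 < j p}) hZX hX (fun p => p.1)
    (fun p => p.2) (fun _ => 1)
    (fun p hp => ⟨(hdig p hp.1).1, (hdig p hp.1).2.1, le_rfl⟩)
    (by
      rintro p ⟨hp, ht0, hj1, hb1, hjw⟩
      obtain ⟨h1, h2, h3, h4, h5, h6, h7, h8, h9⟩ := hdig p hp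
      refine hZ p hp _ _ ?_
      rw [ht0, hb1] at h8
      have h10 : A * (A - 1) ≤ A * (2 * j p) := mul_le_mul_of_nonneg_left (by omega) (by omega)
      calc p.2 * 1 * (A * (A - 1)) = p.2 * (A * (A - 1)) := by ring
        _ ≤ p.2 * (2 * s p) := mul_le_mul_of_nonneg_left (by linarith) (by omega)
        _ = _ := by ring)
    (by
      rintro p ⟨hp, ht0, hj1, hb1, hjw⟩ p' ⟨hp', ht0', hj1', hb1', hjw'⟩ h1 h2 _
      exact Prod.ext h1 h2)
  obtain ⟨hf₄, hc₄⟩ := ncard_le_of_injOn_triple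
    (U := {p ∈ T | t p = 0 ∧ 1 ≤ j p ∧ 2 ≤ b p}) hZX hX (fun p => p.1)
    j (fun p => b p - 1)
    (fun p hp => ⟨(hdig p hp.1).1, hp.2.2.1, by have := hp.2.2.2; omega⟩)
    (by
      rintro p ⟨hp, ht0, hj1, hb2⟩
      obtain ⟨h1, h2, h3, h4, h5, h6, h7, h8, h9⟩ := hdig p hp
      refine hZ p hp _ _ ?_
      rw [ht0] at h8
      calc j p * (b p - 1) * (A * (A - 1)) = (A * j p) * ((A - 1) * (b p - 1)) := by ring
        _ ≤ _ := mul_le_mul (by omega) (by linarith) (mul_nonneg (by omega) (by omega))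
          (hs1 p hp |>.trans' zero_le_one))
    (by
      rintro p ⟨hp, ht0, hj1, hb2⟩ p' ⟨hp', ht0', hj1', hb2'⟩ h1 h2 h3
      refine Prod.ext h1 ?_
      have h4 : b p = b p' := by simpa using h3
      rw [(hdig p hp).2.2.2.2.2.2.2.1, (hdig p' hp').2.2.2.2.2.2.2.1, ht0, ht0', h2, h4])
  obtain ⟨hf₅, hc₅⟩ := ncard_le_of_injOn_triple
    (U := {p ∈ T | 1 ≤ t p}) hZX hX (fun p => p.1) s t
    (fun p hp => ⟨(hdig p hp.1).1, hs1 p hp.1, hp.2⟩)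
    (by
      rintro p ⟨hp, ht1⟩
      obtain ⟨h1, h2, h3, h4, h5, h6, h7, h8, h9⟩ := hdig p hp
      refine hZ p hp _ _ ?_
      have h10 : (A - 1) * 1 ≤ (A - 1) * b p := mul_le_mul_of_nonneg_left h4 (by omega)
      calc s p * t p * (A * (A - 1)) = s p * (t p * (A * (A - 1))) := by ring
        _ ≤ _ := mul_le_mul_of_nonneg_left (by linarith) (hs1 p hp |>.trans' zero_le_one))
    (by
      rintro p ⟨hp, ht1⟩ p' ⟨hp', ht1'⟩ h1 h2 h3
      refine Prod.ext h1 ?_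
      obtain ⟨h4, h5⟩ := hdig_eq p p' h2
      rw [(hdig p hp).2.2.2.2.2.2.2.1, (hdig p' hp').2.2.2.2.2.2.2.1, h3, h4, h5])
  rw [habs] at hc₂ hc₃ hc₄ hc₅
  set U₁ := {p ∈ T | t p = 0 ∧ j p = 0}
  set U₂ := {p ∈ T | t p = 0 ∧ 1 ≤ j p ∧ b p = 1 ∧ j p ≤ p.2}
  set U₃ := {p ∈ T | t p = 0 ∧ 1 ≤ j p ∧ b p = 1 ∧ p.2 < j p}
  set U₄ := {p ∈ T | t p = 0 ∧ 1 ≤ j p ∧ 2 ≤ b p}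
  set U₅ := {p ∈ T | 1 ≤ t p}
  have hsub : T ⊆ U₁ ∪ (U₂ ∪ (U₃ ∪ (U₄ ∪ U₅))) := by
    intro p hp
    obtain ⟨h1, h2, h3, h4, h5, h6, h7, h8, h9⟩ := hdig p hp
    simp only [U₁, U₂, U₃, U₄, U₅, Set.mem_union, Set.mem_ofPred_eq, hp, true_and]
    omega
  have hcard : T.ncard ≤ U₁.ncard + (U₂.ncard + (U₃.ncard + (U₄.ncard + U₅.ncard))) := by
    refine (Set.ncard_le_ncard hsub
      (hf₁.union (hf₂.union (hf₃.union (hf₄.union hf₅))))).trans ?_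
    refine (Set.ncard_union_le _ _).trans (Nat.add_le_add_left ?_ _)
    refine (Set.ncard_union_le _ _).trans (Nat.add_le_add_left ?_ _)
    refine (Set.ncard_union_le _ _).trans (Nat.add_le_add_left ?_ _)
    exact Set.ncard_union_le _ _
  rw [← Nat.cast_le (α := ℝ)] at hcard
  push_cast at hcard
  linarith

theorem ncard_cone_norm_le {a : ℤ} (ha : 8 ≤ a) {K : Type} [Field K] [NumberField K]
    (σ : K →+* ℝ) {ρ : K} (hσ : σ ρ = simplestCubicRoot a)
    (hρ : IntermediateField.adjoin ℚ {ρ} = ⊤) {x : ℝ} (hx : 1 ≤ x) :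
    (Set.ncard {p : ℤ × ℤ | 1 ≤ p.2 ∧
        ⌊(-((a : ℝ) + 1) * p.2) / ((a : ℝ) ^ 2 + 3 * a + 3)⌋ + 2 ≤ p.1 ∧
        ((Algebra.norm ℚ ((p.1 : K) - (p.2 : K) * ρ +
          ((⌊(((a : ℝ) + 2) * p.2) / ((a : ℝ) ^ 2 + 3 * a + 3)⌋ + 1 : ℤ) : K)
            * ρ ^ 2) : ℚ) : ℝ) ≤ x} : ℝ) ≤
      4 * (2 * (2 * x) / ((a + 2) * (a + 1)) * (1 + Real.log (2 * x)) ^ 2) +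
        4 * (2 * x / (a + 1)) ^ ((2 : ℝ) / 3) := by
  have ha' : (8 : ℝ) ≤ a := by exact_mod_cast ha
  set D : ℝ := (a : ℝ) ^ 2 + 3 * a + 3 with hD
  have hDpos : 0 < D := by positivity
  set S := {p : ℤ × ℤ | _}
  set g : ℤ × ℤ → ℤ × ℤ := fun p => (p.1 - ⌊(-((a : ℝ) + 1) * p.2) / D⌋ - 1, p.2)
  have hg : g.Injective := by
    rintro ⟨m, w⟩ ⟨m', w'⟩ h
    simp only [g, Prod.mk.injEq] at h
    obtain ⟨h1, rfl⟩ := h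
    exact Prod.ext (by simpa using h1) rfl
  have hT := ncard_cone_points_le (A := a + 2) (by omega) (X := 2 * x) (by linarith)
    (T := g '' S) (v := fun w => ⌊(((a : ℝ) + 2) * w) / D⌋ + 1) ?_
  · rw [Set.ncard_image_of_injective S hg] at hT
    push_cast at hT
    rwa [show (a : ℝ) + 2 - 1 = a + 1 by ring] at hT
  · rintro _ ⟨⟨m, w⟩, ⟨hw, hm, hN⟩, rfl⟩
    simp only at hw hm hN
    simp only [g]
    set q := ⌊(-((a : ℝ) + 1) * w) / D⌋
    set v := ⌊(((a : ℝ) + 2) * w) / D⌋ + 1 with hv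
    have hvlo : ((a : ℝ) + 2) * w < v * D := by
      rw [← div_lt_iff₀ hDpos, hv]; push_cast; exact Int.lt_floor_add_one _
    have hvhi : ((v : ℝ) - 1) * D ≤ ((a : ℝ) + 2) * w := by
      rw [← le_div_iff₀ hDpos, hv]; push_cast; rw [add_sub_cancel_right]; exact Int.floor_le _
    have hq : -((a : ℝ) + 1) * w < (q + 1) * D := by
      rw [← div_lt_iff₀ hDpos]; exact Int.lt_floor_add_one _
    have hs1 : 1 ≤ ((a + 2 - 1) * (a + 2) + 1) * v - (a + 2) * w := by
      have h : ((0 : ℤ) : ℝ) < ((((a + 2 - 1) * (a + 2) + 1) * v - (a + 2) * w : ℤ) : ℝ) := by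
        push_cast; rw [hD] at hvlo; linarith
      have := Int.cast_lt.1 h
      omega
    have hsD : ((a + 2 - 1) * (a + 2) + 1) * v - (a + 2) * w ≤ (a + 2 - 1) * (a + 2) + 1 := by
      rw [← Int.cast_le (R := ℝ)]
      push_cast; rw [hD] at hvhi; linarith
    refine ⟨by omega, hw, hs1, hsD, ?_⟩
    have hk : (0 : ℝ) ≤ ((m - q - 1 : ℤ) : ℝ) := by exact_mod_cast (by omega : 0 ≤ m - q - 1)
    have hs0 : (0 : ℝ) ≤ ((((a + 2 - 1) * (a + 2) + 1) * v - (a + 2) * w : ℤ) : ℝ) := by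
      exact_mod_cast (by omega : 0 ≤ ((a + 2 - 1) * (a + 2) + 1) * v - (a + 2) * w)
    have hle := le_norm_simplestCubic ha σ hσ hρ (m := m) (w := w) (v := v) hk (by omega) hs0
      (by push_cast; ring) (by rw [← hD]; push_cast; linarith)
    rw [Int.cast_mul, Int.cast_mul, Int.cast_add, Int.cast_add]
    linarith

theorem stmt_15 :
    ∀ r : ℝ, 0 < r →
    ∃ C : ℝ, 0 < C ∧
      ∀ (a : ℤ), 8 ≤ a →
      ∀ (K : Type) [Field K] [NumberField K] (σ : K →+* ℝ) (ρK : K),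
        σ ρK = simplestCubicRoot a →
        IntermediateField.adjoin ℚ {ρK} = ⊤ →
        ∀ x : ℝ, 1 ≤ x → x ≤ (a : ℝ) ^ r →
          (Set.ncard {p : ℤ × ℤ | 1 ≤ p.2 ∧
              ⌊(-((a : ℝ) + 1) * p.2) / ((a : ℝ) ^ 2 + 3 * a + 3)⌋ + 2 ≤ p.1 ∧
              ((Algebra.norm ℚ ((p.1 : K) - (p.2 : K) * ρK +
                ((⌊(((a : ℝ) + 2) * p.2) / ((a : ℝ) ^ 2 + 3 * a + 3)⌋ + 1 : ℤ) : K)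
                  * ρK ^ 2) : ℚ) : ℝ) ≤ x} : ℝ) ≤
            C * ((Real.log a) ^ 2 * x / (a : ℝ) ^ 2 + (x / a) ^ ((2 : ℝ) / 3)) := by
  intro r hr
  refine ⟨16 * (r + 2) ^ 2 + 8, by positivity, ?_⟩
  intro a ha K _ _ σ ρK hσ hρ x hx hxa
  refine (ncard_cone_norm_le ha σ hσ hρ hx).trans ?_
  have ha' : (8 : ℝ) ≤ a := by exact_mod_cast ha
  have hapos : (0 : ℝ) < a := by linarith
  have hx0 : 0 < x := by linarith
  have hloga : 1 ≤ Real.log a := by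
    rw [Real.le_log_iff_exp_le hapos]
    linarith [Real.exp_one_lt_d9]
  have hlogx : Real.log (2 * x) ≤ (r + 1) * Real.log a := by
    rw [Real.log_mul two_ne_zero hx0.ne', add_one_mul, add_comm]
    refine add_le_add ?_ (Real.log_le_log two_pos (by linarith))
    rw [← Real.log_rpow hapos]
    exact Real.log_le_log hx0 hxa
  have hlogx0 : 0 ≤ Real.log (2 * x) := Real.log_nonneg (by linarith)
  have h1 : 4 * (2 * (2 * x) / (((a : ℝ) + 2) * (a + 1)) * (1 + Real.log (2 * x)) ^ 2) ≤
      16 * (r + 2) ^ 2 * (Real.log a ^ 2 * x / a ^ 2) := by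
    calc _ ≤ 4 * (2 * (2 * x) / (a * a) * ((r + 2) * Real.log a) ^ 2) := by
          gcongr <;> linarith
      _ = _ := by ring
  have h2 : (2 * x / ((a : ℝ) + 1)) ^ ((2 : ℝ) / 3) ≤ 2 * (x / a) ^ ((2 : ℝ) / 3) := by
    calc (2 * x / ((a : ℝ) + 1)) ^ ((2 : ℝ) / 3) ≤ (2 * (x / a)) ^ ((2 : ℝ) / 3) := by
          rw [← mul_div_assoc]
          gcongr
          linarith
      _ = 2 ^ ((2 : ℝ) / 3) * (x / a) ^ ((2 : ℝ) / 3) :=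
          Real.mul_rpow two_pos.le (by positivity)
      _ ≤ 2 ^ (1 : ℝ) * (x / a) ^ ((2 : ℝ) / 3) := by
          gcongr <;> norm_num
      _ = _ := by rw [Real.rpow_one]
  have h3 : 0 ≤ Real.log a ^ 2 * x / (a : ℝ) ^ 2 := by positivity
  have h4 : 0 ≤ (r + 2) ^ 2 * (x / (a : ℝ)) ^ ((2 : ℝ) / 3) := by positivity
  linarith
end
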